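/- arXiv:2002.06014 — 4 statements merged into one kernel-verified Lean document; each statement's English description precedes it below -/
import Mathlib

section
/- Let r ≥ 0 and let G be a maximal outerplanar graph of order n ≥ 2r+4. Then G has a diagonal d that partitions it into two maximal outerplanar graphs G1 and G2 such that G1 contains exactly ℓ Hamiltonian edges of G for some ℓ with r+2 ≤ ℓ ≤ 2r+2. -/
namespace MopPaper

/-- Cyclic successor on `Fin n`. -/
def finNext {n : ℕ} (i : Fin n) : Fin n := ⟨(i.val + 1) % n, Nat.mod_lt _ i.pos⟩

/-- A witness that `G` is a maximal outerplanar graph (mop): a cyclic ordering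
`σ` of the vertices such that all Hamiltonian (boundary) edges are present,
no two edges cross with respect to the cyclic order (outerplanarity),
and `G` has exactly `2n - 3` edges (edge-maximality, i.e. a triangulation). -/
def MopWitness {V : Type*} (G : SimpleGraph V) (n : ℕ) (σ : Fin n ≃ V) : Prop :=
  (∀ i : Fin n, G.Adj (σ i) (σ (finNext i))) ∧
  (∀ a b c d : Fin n, G.Adj (σ a) (σ b) → G.Adj (σ c) (σ d) →
      ¬ (a < c ∧ c < b ∧ b < d)) ∧
  Nat.card G.edgeSet = 2 * n - 3

/-- `G` is a maximal outerplanar graph (on at least 3 vertices). -/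
def IsMop {V : Type*} (G : SimpleGraph V) : Prop :=
  ∃ n : ℕ, 3 ≤ n ∧ ∃ σ : Fin n ≃ V, MopWitness G n σ

/-- `uv` is a Hamiltonian edge of the mop `G`: an edge lying on the (unique)
Hamiltonian cycle of `G`. -/
def IsHamEdge {V : Type*} (G : SimpleGraph V) (u v : V) : Prop :=
  ∃ n : ℕ, 3 ≤ n ∧ ∃ σ : Fin n ≃ V, MopWitness G n σ ∧
    ∃ i : Fin n, (σ i = u ∧ σ (finNext i) = v) ∨ (σ i = v ∧ σ (finNext i) = u)

/-- The closed neighborhood `N[S]` of a set of vertices. -/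
def closedNbhd {V : Type*} (G : SimpleGraph V) (S : Set V) : Set V :=
  S ∪ {v | ∃ u ∈ S, G.Adj u v}

/-- The set of vertices of degree 2. -/
def deg2set {V : Type*} (G : SimpleGraph V) : Set V :=
  {v | (G.neighborSet v).ncard = 2}

/-- `S` is a `K_{1,k+1}`-isolating set of `G`: every vertex of `G - N[S]`
has at most `k` neighbors in `G - N[S]`. -/
def IsKIsolating {V : Type*} (G : SimpleGraph V) (k : ℕ) (S : Set V) : Prop :=
  ∀ v ∈ (closedNbhd G S)ᶜ, (G.neighborSet v ∩ (closedNbhd G S)ᶜ).ncard ≤ k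

/-- The `K_{1,k+1}`-isolation number `ι_k(G)`. -/
noncomputable def iotaK {V : Type*} (G : SimpleGraph V) (k : ℕ) : ℕ :=
  sInf {m | ∃ S : Set V, S.Finite ∧ IsKIsolating G k S ∧ S.ncard = m}

/-- `S` is an `H`-isolating set of `G`: the graph `G - N[S]` contains no
subgraph isomorphic to `H`. -/
def IsIsolating {V W : Type*} (G : SimpleGraph V) (H : SimpleGraph W) (S : Set V) : Prop :=
  ¬ ∃ f : W → ((closedNbhd G S)ᶜ : Set V), Function.Injective f ∧
      ∀ a b : W, H.Adj a b → G.Adj (f a).1 (f b).1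

/-- The `H`-isolation number `ι(G, H)`. -/
noncomputable def isolationNumber {V W : Type*} (G : SimpleGraph V) (H : SimpleGraph W) : ℕ :=
  sInf {m | ∃ S : Set V, S.Finite ∧ IsIsolating G H S ∧ S.ncard = m}

/-- The domination number `γ(G)`. -/
noncomputable def dominationNumber {V : Type*} (G : SimpleGraph V) : ℕ :=
  sInf {m | ∃ S : Set V, S.Finite ∧ closedNbhd G S = Set.univ ∧ S.ncard = m}

/-- An enumeration of the vertices of a mop along its Hamiltonian cycle, indexed by the natural
numbers below `n`. -/
structure IsMopEnum {V : Type*} (G : SimpleGraph V) (n : ℕ) (w : ℕ → V) : Prop where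
  inj : ∀ a b, a < n → b < n → w a = w b → a = b
  surj : ∀ v, ∃ a, a < n ∧ w a = v
  adj_succ : ∀ a, a + 1 < n → G.Adj (w a) (w (a + 1))
  adj_last : G.Adj (w (n - 1)) (w 0)
  noncrossing : ∀ a b c d, a < c → c < b → b < d → d < n →
    G.Adj (w a) (w b) → ¬ G.Adj (w c) (w d)
  ncard_edgeSet : G.edgeSet.ncard = 2 * n - 3

theorem finNext_val_of_lt {n : ℕ} (i : Fin n) (h : i.val + 1 < n) :
    (finNext i).val = i.val + 1 := Nat.mod_eq_of_lt h

theorem finNext_val_of_eq {n : ℕ} (i : Fin n) (h : i.val + 1 = n) :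
    (finNext i).val = 0 := by
  simp [finNext, h]

theorem IsMopEnum.exists_mopWitness {V : Type*} {G : SimpleGraph V} {n : ℕ} {w : ℕ → V}
    (h : IsMopEnum G n w) : ∃ σ : Fin n ≃ V, (∀ i, σ i = w i.val) ∧ MopWitness G n σ := by
  have hbij : Function.Bijective (fun i : Fin n => w i.val) := by
    refine ⟨fun a b hab => Fin.ext (h.inj _ _ a.2 b.2 hab), fun v => ?_⟩
    obtain ⟨a, ha, rfl⟩ := h.surj v
    exact ⟨⟨a, ha⟩, rfl⟩
  refine ⟨Equiv.ofBijective _ hbij, fun i => rfl, fun i => ?_, ?_, h.ncard_edgeSet⟩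
  · change G.Adj (w i.val) (w (finNext i).val)
    rcases Nat.lt_or_ge (i.val + 1) n with hi | hi
    · rw [finNext_val_of_lt i hi]
      exact h.adj_succ _ hi
    · have hi' : i.val + 1 = n := by omega
      rw [finNext_val_of_eq i hi']
      have := h.adj_last
      rwa [← hi'] at this
  · rintro a b c d hab hcd ⟨h1, h2, h3⟩
    exact h.noncrossing a b c d h1 h2 h3 d.2 hab hcd

theorem IsMopEnum.isMop {V : Type*} {G : SimpleGraph V} {n : ℕ} {w : ℕ → V}
    (h : IsMopEnum G n w) (hn : 3 ≤ n) : IsMop G := by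
  obtain ⟨σ, -, hσ⟩ := h.exists_mopWitness
  exact ⟨n, hn, σ, hσ⟩

theorem MopWitness.exists_isMopEnum {V : Type*} {G : SimpleGraph V} {n : ℕ} {σ : Fin n ≃ V}
    (h : MopWitness G n σ) (hn : 0 < n) :
    ∃ w : ℕ → V, (∀ i : Fin n, σ i = w i.val) ∧ IsMopEnum G n w := by
  let w : ℕ → V := fun a => if ha : a < n then σ ⟨a, ha⟩ else σ ⟨0, hn⟩
  have hw : ∀ a (ha : a < n), w a = σ ⟨a, ha⟩ := fun a ha => dif_pos ha
  refine ⟨w, fun i => (hw i.val i.2).symm, ?_, ?_, ?_, ?_, ?_, h.2.2⟩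
  · intro a b ha hb hab
    rw [hw a ha, hw b hb] at hab
    simpa using σ.injective hab
  · intro v
    exact ⟨(σ.symm v).val, (σ.symm v).2, by rw [hw _ (σ.symm v).2]; simp⟩
  · intro a ha
    have := h.1 ⟨a, by omega⟩
    rw [hw a (by omega), hw (a + 1) ha]
    convert this using 2
    exact Fin.ext (finNext_val_of_lt ⟨a, by omega⟩ ha).symm
  · have := h.1 ⟨n - 1, by omega⟩
    rw [hw (n - 1) (by omega), hw 0 hn]
    convert this using 2
    exact Fin.ext (finNext_val_of_eq ⟨n - 1, by omega⟩ (by simp; omega)).symm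
  · intro a b c d h1 h2 h3 hd hab hcd
    rw [hw a (by omega), hw b (by omega)] at hab
    rw [hw c (by omega), hw d hd] at hcd
    exact h.2.1 _ _ _ _ hab hcd ⟨h1, h2, h3⟩

/-- Deleting the endpoints of a Hamiltonian edge leaves a connected graph. -/
theorem IsHamEdge.propagate {V : Type*} {G : SimpleGraph V} {u v : V} (h : IsHamEdge G u v)
    (Q : V → Prop)
    (hQ : ∀ x y, x ≠ u → x ≠ v → y ≠ u → y ≠ v → G.Adj x y → Q x → Q y)
    {x y : V} (hxu : x ≠ u) (hxv : x ≠ v) (hyu : y ≠ u) (hyv : y ≠ v) (hx : Q x) : Q y := by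
  obtain ⟨n, hn, τ, hτ, p, hp⟩ := h
  have hn0 : 0 < n := by omega
  let t : ℕ → V := fun a => τ ⟨a % n, Nat.mod_lt _ hn0⟩
  have hadj : ∀ a, G.Adj (t a) (t (a + 1)) := by
    intro a
    have := hτ.1 ⟨a % n, Nat.mod_lt _ hn0⟩
    simpa [t, finNext] using this
  have hinj : ∀ a k, 0 < k → k < n → t (a + k) ≠ t a := by
    intro a k hk hkn hak
    have h1 : (a + k) % n = a % n := by simpa [t] using hak
    have h2 : n ∣ a + k - a := (Nat.modEq_iff_dvd' (by omega)).1 h1.symm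
    have h3 := Nat.le_of_dvd (by omega) h2
    omega
  have hpt : τ p = t p.val := by
    simp [t, Nat.mod_eq_of_lt p.2]
  have hpt1 : τ (finNext p) = t (p.val + 1) := rfl
  have hne : ∀ k, k + 3 ≤ n → t (p.val + 2 + k) ≠ u ∧ t (p.val + 2 + k) ≠ v := by
    intro k hk
    have h1 := hinj p.val (2 + k) (by omega) (by omega)
    have h2 := hinj (p.val + 1) (1 + k) (by omega) (by omega)
    rw [show p.val + (2 + k) = p.val + 2 + k by ring] at h1
    rw [show p.val + 1 + (1 + k) = p.val + 2 + k by ring] at h2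
    rw [← hpt] at h1
    rw [← hpt1] at h2
    rcases hp with ⟨rfl, rfl⟩ | ⟨rfl, rfl⟩
    · exact ⟨h1, h2⟩
    · exact ⟨h2, h1⟩
  have hpath : ∀ k, k + 3 ≤ n → (Q (t (p.val + 2)) ↔ Q (t (p.val + 2 + k))) := by
    intro k
    induction k with
    | zero => intro _; rfl
    | succ k ih =>
      intro hk
      rw [ih (by omega)]
      have h1 := hne k (by omega)
      have h2 := hne (k + 1) hk
      have h3 := hadj (p.val + 2 + k)
      exact ⟨hQ _ _ h1.1 h1.2 h2.1 h2.2 h3, hQ _ _ h2.1 h2.2 h1.1 h1.2 h3.symm⟩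
  have hcover : ∀ z, z ≠ u → z ≠ v → ∃ k, k + 3 ≤ n ∧ z = t (p.val + 2 + k) := by
    intro z hzu hzv
    have hzt : ∃ k, k < n ∧ z = t (p.val + k) := by
      have h1 : z = t (τ.symm z).val := by
        simp [t, Nat.mod_eq_of_lt (τ.symm z).2]
      rcases Nat.lt_or_ge (τ.symm z).val p.val with h2 | h2
      · refine ⟨(τ.symm z).val + n - p.val, by omega, ?_⟩
        rw [show p.val + ((τ.symm z).val + n - p.val) = (τ.symm z).val + n by omega]
        rw [h1]
        simp [t]
      · refine ⟨(τ.symm z).val - p.val, by omega, ?_⟩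
        rw [show p.val + ((τ.symm z).val - p.val) = (τ.symm z).val by omega]
        exact h1
    obtain ⟨k, hk, hz⟩ := hzt
    have hk0 : k ≠ 0 := by
      rintro rfl
      have : z = τ p := by rw [hz, hpt]; rfl
      rcases hp with ⟨h1, h2⟩ | ⟨h1, h2⟩ <;> simp_all
    have hk1 : k ≠ 1 := by
      rintro rfl
      have : z = τ (finNext p) := by rw [hz, hpt1]
      rcases hp with ⟨h1, h2⟩ | ⟨h1, h2⟩ <;> simp_all
    refine ⟨k - 2, by omega, ?_⟩
    rw [show p.val + 2 + (k - 2) = p.val + k by omega]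
    exact hz
  obtain ⟨k, hk, rfl⟩ := hcover x hxu hxv
  obtain ⟨l, hl, rfl⟩ := hcover y hyu hyv
  exact (hpath l hl).1 ((hpath k hk).2 hx)

/-- In a mop enumeration an edge whose endpoints are not cyclically consecutive is a diagonal. -/
theorem IsMopEnum.not_isHamEdge {V : Type*} {G : SimpleGraph V} {n : ℕ} {w : ℕ → V}
    (h : IsMopEnum G n w) {i j : ℕ} (hij : i + 2 ≤ j) (hj : j < n) (hlast : j - i + 1 < n)
    (hadj : G.Adj (w i) (w j)) : ¬ IsHamEdge G (w i) (w j) := by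
  intro hham
  have hne : ∀ a b, a < n → b < n → a ≠ b → w a ≠ w b := fun a b ha hb hab hw =>
    hab (h.inj a b ha hb hw)
  obtain ⟨d, hd, hdij⟩ : ∃ d, d < n ∧ (d < i ∨ j < d) := by
    rcases Nat.eq_zero_or_pos i with h0 | h0
    · exact ⟨j + 1, by omega, by omega⟩
    · exact ⟨0, by omega, by omega⟩
  have hQ : ∀ x y, x ≠ w i → x ≠ w j → y ≠ w i → y ≠ w j → G.Adj x y →
      (∃ a, i < a ∧ a < j ∧ x = w a) → ∃ a, i < a ∧ a < j ∧ y = w a := by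
    rintro x y - - hyi hyj hxy ⟨a, ha, ha', rfl⟩
    obtain ⟨b, hb, rfl⟩ := h.surj y
    have hbi : b ≠ i := by rintro rfl; exact hyi rfl
    have hbj : b ≠ j := by rintro rfl; exact hyj rfl
    refine ⟨b, ?_, ?_, rfl⟩
    · by_contra hlt
      exact h.noncrossing b a i j (by omega) ha ha' hj hxy.symm hadj
    · by_contra hlt
      exact h.noncrossing i j a b ha ha' (by omega) hb hadj hxy
  obtain ⟨a, h1, h2, h3⟩ := hham.propagate (fun x => ∃ a, i < a ∧ a < j ∧ x = w a) hQ
    (x := w (i + 1)) (y := w d)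
    (hne _ _ (by omega) (by omega) (by omega)) (hne _ _ (by omega) (by omega) (by omega))
    (hne _ _ (by omega) (by omega) (by omega)) (hne _ _ (by omega) (by omega) (by omega))
    ⟨i + 1, by omega, by omega, rfl⟩
  have := h.inj _ _ hd (by omega) h3
  omega

theorem IsMopEnum.isHamEdge_succ {V : Type*} {G : SimpleGraph V} {n : ℕ} {w : ℕ → V}
    (h : IsMopEnum G n w) (hn : 3 ≤ n) {k : ℕ} (hk : k + 1 < n) :
    IsHamEdge G (w k) (w (k + 1)) := by
  obtain ⟨σ, hw, hσ⟩ := h.exists_mopWitness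
  refine ⟨n, hn, σ, hσ, ⟨k, by omega⟩, Or.inl ⟨hw _, ?_⟩⟩
  rw [hw, finNext_val_of_lt _ hk]

theorem IsHamEdge.symm {V : Type*} {G : SimpleGraph V} {u v : V} (h : IsHamEdge G u v) :
    IsHamEdge G v u := by
  obtain ⟨n, hn, σ, hσ, i, hi⟩ := h
  exact ⟨n, hn, σ, hσ, i, hi.symm⟩

open Classical in
/-- The edges among the vertices `w a`, for the indices `a < n` satisfying `P`, as ordered pairs
of indices. -/
noncomputable def chords {V : Type*} (G : SimpleGraph V) (n : ℕ) (w : ℕ → V) (P : ℕ → Prop) :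
    Finset (ℕ × ℕ) :=
  (Finset.range n ×ˢ Finset.range n).filter
    fun p => p.1 < p.2 ∧ G.Adj (w p.1) (w p.2) ∧ P p.1 ∧ P p.2

theorem mem_chords {V : Type*} {G : SimpleGraph V} {n : ℕ} {w : ℕ → V} {P : ℕ → Prop}
    {p : ℕ × ℕ} :
    p ∈ chords G n w P ↔ p.1 < p.2 ∧ p.2 < n ∧ G.Adj (w p.1) (w p.2) ∧ P p.1 ∧ P p.2 := by
  simp only [chords, Finset.mem_filter, Finset.mem_product, Finset.mem_range]
  constructor
  · rintro ⟨⟨-, h2⟩, h3, h4⟩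
    exact ⟨h3, h2, h4⟩
  · rintro ⟨h3, h2, h4⟩
    exact ⟨⟨by omega, h2⟩, h3, h4⟩

/-- The set of vertices `w a` with `a < n` satisfying `P`. -/
def segment {V : Type*} (n : ℕ) (w : ℕ → V) (P : ℕ → Prop) : Set V :=
  {v | ∃ a, a < n ∧ P a ∧ w a = v}

/-- The subgraph induced by the vertices `w a` with `a < n` satisfying `P`. -/
def segmentGraph {V : Type*} (G : SimpleGraph V) (n : ℕ) (w : ℕ → V) (P : ℕ → Prop) :
    G.Subgraph :=
  (⊤ : G.Subgraph).induce (segment n w P)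

namespace IsMopEnum

variable {V : Type*} {G : SimpleGraph V} {n : ℕ} {w : ℕ → V}

theorem mem_segment (h : IsMopEnum G n w) {P : ℕ → Prop} {a : ℕ} (ha : a < n) :
    w a ∈ segment n w P ↔ P a := by
  constructor
  · rintro ⟨b, hb, hP, hba⟩
    rwa [← h.inj b a hb ha hba]
  · exact fun hP => ⟨a, ha, hP, rfl⟩

theorem segmentGraph_adj (h : IsMopEnum G n w) {P : ℕ → Prop} {a b : ℕ} (ha : a < n)
    (hb : b < n) :
    (segmentGraph G n w P).Adj (w a) (w b) ↔ P a ∧ P b ∧ G.Adj (w a) (w b) := by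
  simp [segmentGraph, h.mem_segment ha, h.mem_segment hb]

theorem edgeSet_segmentGraph (h : IsMopEnum G n w) (P : ℕ → Prop) :
    (segmentGraph G n w P).edgeSet = (fun p : ℕ × ℕ => s(w p.1, w p.2)) '' chords G n w P := by
  ext e
  induction e using Sym2.ind with | h x y =>
  obtain ⟨a, ha, rfl⟩ := h.surj x
  obtain ⟨b, hb, rfl⟩ := h.surj y
  rw [SimpleGraph.Subgraph.mem_edgeSet, h.segmentGraph_adj ha hb]
  constructor
  · rintro ⟨hPa, hPb, hab⟩
    have hne : a ≠ b := by rintro rfl; exact hab.ne rfl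
    rcases Nat.lt_or_gt_of_ne hne with hlt | hlt
    · exact ⟨(a, b), mem_chords.2 ⟨hlt, hb, hab, hPa, hPb⟩, rfl⟩
    · exact ⟨(b, a), mem_chords.2 ⟨hlt, ha, hab.symm, hPb, hPa⟩, Sym2.eq_swap⟩
  · rintro ⟨⟨c, d⟩, hp, heq⟩
    obtain ⟨hcd, hd, hadj, hc', hd'⟩ := mem_chords.1 hp
    dsimp only at *
    rcases Sym2.eq_iff.1 heq with ⟨h1, h2⟩ | ⟨h1, h2⟩
    · obtain rfl := h.inj _ _ (by omega) ha h1
      obtain rfl := h.inj _ _ hd hb h2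
      exact ⟨hc', hd', hadj⟩
    · obtain rfl := h.inj _ _ (by omega) hb h1
      obtain rfl := h.inj _ _ hd ha h2
      exact ⟨hd', hc', hadj.symm⟩

theorem injOn_chords (h : IsMopEnum G n w) (P : ℕ → Prop) :
    Set.InjOn (fun p : ℕ × ℕ => s(w p.1, w p.2)) (chords G n w P) := by
  rintro ⟨a, b⟩ hp ⟨c, d⟩ hq heq
  obtain ⟨hab, hb, -⟩ := mem_chords.1 hp
  obtain ⟨hcd, hd, -⟩ := mem_chords.1 hq
  dsimp only at *
  rcases Sym2.eq_iff.1 heq with ⟨h1, h2⟩ | ⟨h1, h2⟩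
  · rw [h.inj _ _ (by omega) (by omega) h1, h.inj _ _ hb hd h2]
  · have := h.inj _ _ (by omega) hd h1
    have := h.inj _ _ hb (by omega) h2
    omega

theorem ncard_edgeSet_segmentGraph (h : IsMopEnum G n w) (P : ℕ → Prop) :
    (segmentGraph G n w P).edgeSet.ncard = (chords G n w P).card := by
  rw [h.edgeSet_segmentGraph, (h.injOn_chords P).ncard_image, Set.ncard_coe_finset]

theorem card_chords_true (h : IsMopEnum G n w) :
    (chords G n w fun _ => True).card = 2 * n - 3 := by
  rw [← h.ncard_edgeSet_segmentGraph, ← h.ncard_edgeSet]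
  congr 1
  ext e
  induction e using Sym2.ind with | h x y =>
  obtain ⟨a, ha, rfl⟩ := h.surj x
  obtain ⟨b, hb, rfl⟩ := h.surj y
  simp [h.segmentGraph_adj ha hb]

/-- An induced subgraph whose boundary closes up and which has the maximum number of edges is
a mop. -/
theorem isMop_segmentGraph (h : IsMopEnum G n w) {P : ℕ → Prop} {m : ℕ} (hm : 3 ≤ m) (φ : ℕ → ℕ)
    (hφ : StrictMono φ) (hφn : ∀ a, a < m → φ a < n)
    (hP : ∀ b, b < n → (P b ↔ ∃ a, a < m ∧ φ a = b))
    (hsucc : ∀ a, a + 1 < m → G.Adj (w (φ a)) (w (φ (a + 1))))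
    (hlast : G.Adj (w (φ (m - 1))) (w (φ 0)))
    (hcard : (chords G n w P).card = 2 * m - 3) : IsMop (segmentGraph G n w P).coe := by
  have hmem : ∀ a, a < m → w (φ a) ∈ segment n w P := fun a ha =>
    (h.mem_segment (hφn a ha)).2 ((hP _ (hφn a ha)).2 ⟨a, ha, rfl⟩)
  let z : ℕ → (segmentGraph G n w P).verts := fun a =>
    if ha : a < m then ⟨w (φ a), hmem a ha⟩ else ⟨w (φ 0), hmem 0 (by omega)⟩
  have hz : ∀ a, a < m → (z a : V) = w (φ a) := by
    intro a ha
    simp [z, ha]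
  have hadj : ∀ a b, a < m → b < m →
      ((segmentGraph G n w P).coe.Adj (z a) (z b) ↔ G.Adj (w (φ a)) (w (φ b))) := by
    intro a b ha hb
    rw [SimpleGraph.Subgraph.coe_adj, hz a ha, hz b hb, h.segmentGraph_adj (hφn a ha) (hφn b hb)]
    have h1 := (hP _ (hφn a ha)).2 ⟨a, ha, rfl⟩
    have h2 := (hP _ (hφn b hb)).2 ⟨b, hb, rfl⟩
    simp [h1, h2]
  refine IsMopEnum.isMop (n := m) (w := z) ⟨?_, ?_, ?_, ?_, ?_, ?_⟩ hm
  · intro a b ha hb hab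
    have h1 : w (φ a) = w (φ b) := by rw [← hz a ha, ← hz b hb, hab]
    exact hφ.injective (h.inj _ _ (hφn a ha) (hφn b hb) h1)
  · rintro ⟨v, b, hb, hPb, rfl⟩
    obtain ⟨a, ha, rfl⟩ := (hP b hb).1 hPb
    exact ⟨a, ha, Subtype.ext (hz a ha)⟩
  · intro a ha
    exact (hadj _ _ (by omega) ha).2 (hsucc a ha)
  · exact (hadj _ _ (by omega) (by omega)).2 hlast
  · intro a b c d h1 h2 h3 hd hab hcd
    exact h.noncrossing _ _ _ _ (hφ h1) (hφ h2) (hφ h3) (hφn d hd)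
      ((hadj _ _ (by omega) (by omega)).1 hab) ((hadj _ _ (by omega) hd).1 hcd)
  · rw [← hcard, ← h.ncard_edgeSet_segmentGraph,
      ← SimpleGraph.Subgraph.image_coe_edgeSet_coe,
      Set.ncard_image_of_injective _ (Sym2.map.injective Subtype.val_injective)]

/-- An interval of length at least two splits at an interior neighbour of its left endpoint. -/
theorem exists_split (h : IsMopEnum G n w) {i j : ℕ} (hij : i + 2 ≤ j) (hj : j < n) :
    ∃ k, i < k ∧ k < j ∧
      chords G n w (fun a => i ≤ a ∧ a ≤ j) ⊆
        (chords G n w (fun a => i ≤ a ∧ a ≤ k) ∪ chords G n w (fun a => k ≤ a ∧ a ≤ j)) ∪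
          chords G n w (fun a => a = i ∨ a = j) := by
  classical
  let K := (Finset.range j).filter fun k => i < k ∧ G.Adj (w i) (w k)
  have hK : K.Nonempty := ⟨i + 1, by
    simp only [K, Finset.mem_filter, Finset.mem_range]
    exact ⟨by omega, by omega, h.adj_succ i (by omega)⟩⟩
  have hmem := K.max'_mem hK
  have hmax : ∀ b, b < j → i < b → G.Adj (w i) (w b) → b ≤ K.max' hK := fun b h1 h2 h3 =>
    K.le_max' b (by simp only [K, Finset.mem_filter, Finset.mem_range]; exact ⟨h1, h2, h3⟩)
  generalize K.max' hK = k at hmem hmax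
  simp only [K, Finset.mem_filter, Finset.mem_range] at hmem
  obtain ⟨hkj, hik, hadj⟩ := hmem
  refine ⟨k, hik, hkj, ?_⟩
  rintro ⟨a, b⟩ hp
  obtain ⟨hab, hb, hadj', ⟨h1, -⟩, -, h2⟩ := mem_chords.1 hp
  simp only [Finset.mem_union, mem_chords]
  dsimp only at *
  have hcross := h.noncrossing i k a b
  have hcase : b ≤ k ∨ k ≤ a ∨ (a = i ∧ b = j) := by
    by_contra hcon
    push Not at hcon
    obtain ⟨h3, h4, h5⟩ := hcon
    rcases Nat.eq_or_lt_of_le h1 with h6 | h6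
    · subst h6
      have := hmax b (by have := h5 rfl; omega) hab hadj'
      omega
    · exact hcross h6 h4 h3 hb hadj hadj'
  rcases hcase with h3 | h3 | ⟨h3, h4⟩
  · exact Or.inl (Or.inl ⟨hab, hb, hadj', ⟨by omega, by omega⟩, by omega, by omega⟩)
  · exact Or.inl (Or.inr ⟨hab, hb, hadj', ⟨by omega, by omega⟩, by omega, by omega⟩)
  · exact Or.inr ⟨hab, hb, hadj', Or.inl h3, Or.inr h4⟩

theorem chords_pair (i j : ℕ) (hij : i < j) (hj : j < n) :
    (G.Adj (w i) (w j) → chords G n w (fun a => a = i ∨ a = j) = {(i, j)}) ∧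
    (¬ G.Adj (w i) (w j) → chords G n w (fun a => a = i ∨ a = j) = ∅) := by
  have key : ∀ p ∈ chords G n w (fun a => a = i ∨ a = j), p = (i, j) ∧ G.Adj (w i) (w j) := by
    rintro ⟨a, b⟩ hp
    obtain ⟨hab, hb, hadj, h1, h2⟩ := mem_chords.1 hp
    dsimp only at *
    obtain rfl : a = i := by omega
    obtain rfl : b = j := by omega
    exact ⟨rfl, hadj⟩
  constructor
  · intro hadj
    ext p
    rw [Finset.mem_singleton]
    refine ⟨fun hp => (key p hp).1, ?_⟩
    rintro rfl
    exact mem_chords.2 ⟨hij, hj, hadj, Or.inl rfl, Or.inr rfl⟩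
  · intro hadj
    exact Finset.eq_empty_of_forall_notMem fun p hp => hadj (key p hp).2

theorem card_chords_interval_le (h : IsMopEnum G n w) (i j : ℕ) (hij : i < j) (hj : j < n) :
    (chords G n w (fun a => i ≤ a ∧ a ≤ j)).card + 1 ≤ 2 * (j - i) ∧
    (¬ G.Adj (w i) (w j) → (chords G n w (fun a => i ≤ a ∧ a ≤ j)).card + 2 ≤ 2 * (j - i)) := by
  classical
  induction hL : j - i using Nat.strong_induction_on generalizing i j with
  | _ L ih =>
  subst hL
  obtain ⟨hp1, hp2⟩ := chords_pair (G := G) (w := w) i j hij hj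
  rcases Nat.lt_or_ge (i + 1) j with hlt | hge
  · obtain ⟨k, hik, hkj, hsub⟩ := h.exists_split hlt hj
    have hc := (Finset.card_le_card hsub).trans ((Finset.card_union_le _ _).trans
      (Nat.add_le_add_right (Finset.card_union_le _ _) _))
    have h1 := (ih (k - i) (by omega) i k hik (by omega) rfl).1
    have h2 := (ih (j - k) (by omega) k j hkj hj rfl).1
    by_cases hadj : G.Adj (w i) (w j)
    · rw [hp1 hadj, Finset.card_singleton] at hc
      exact ⟨by omega, fun hn => absurd hadj hn⟩
    · rw [hp2 hadj, Finset.card_empty] at hc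
      exact ⟨by omega, fun _ => by omega⟩
  · obtain rfl : j = i + 1 := by omega
    have hadj := h.adj_succ i hj
    have heq : (fun a => i ≤ a ∧ a ≤ i + 1) = fun a => a = i ∨ a = i + 1 := by
      ext a
      omega
    rw [heq, hp1 hadj, Finset.card_singleton]
    exact ⟨by omega, fun hn => absurd hadj hn⟩

/-- The interval of indices `[i, j]` spans a triangulated polygon. -/
def Tight (G : SimpleGraph V) (n : ℕ) (w : ℕ → V) (i j : ℕ) : Prop :=
  G.Adj (w i) (w j) ∧ (chords G n w (fun a => i ≤ a ∧ a ≤ j)).card + 1 = 2 * (j - i)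

/-- The triangle below the base of a triangulated polygon. -/
theorem Tight.exists_split (h : IsMopEnum G n w) {i j : ℕ} (hij : i + 2 ≤ j) (hj : j < n)
    (ht : Tight G n w i j) : ∃ k, i < k ∧ k < j ∧ Tight G n w i k ∧ Tight G n w k j := by
  classical
  obtain ⟨k, hik, hkj, hsub⟩ := h.exists_split hij hj
  have hc := (Finset.card_le_card hsub).trans ((Finset.card_union_le _ _).trans
      (Nat.add_le_add_right (Finset.card_union_le _ _) _))
  rw [(chords_pair i j (by omega) hj).1 ht.1, Finset.card_singleton] at hc
  obtain ⟨h1, h1'⟩ := h.card_chords_interval_le i k hik (by omega)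
  obtain ⟨h2, h2'⟩ := h.card_chords_interval_le k j hkj hj
  have ht2 := ht.2
  refine ⟨k, hik, hkj, ⟨?_, by omega⟩, ⟨?_, by omega⟩⟩
  · by_contra hn
    have := h1' hn
    omega
  · by_contra hn
    have := h2' hn
    omega

theorem tight_zero_last (h : IsMopEnum G n w) (hn : 3 ≤ n) : Tight G n w 0 (n - 1) := by
  refine ⟨h.adj_last.symm, ?_⟩
  have heq : chords G n w (fun a => 0 ≤ a ∧ a ≤ n - 1) = chords G n w fun _ => True := by
    ext p
    simp only [mem_chords]
    constructor
    · rintro ⟨h1, h2, h3, -⟩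
      exact ⟨h1, h2, h3, trivial, trivial⟩
    · rintro ⟨h1, h2, h3, -⟩
      exact ⟨h1, h2, h3, by omega, by omega⟩
  rw [heq, h.card_chords_true]
  omega

theorem exists_tight_balanced (h : IsMopEnum G n w) {r : ℕ} (hn : 2 * r + 4 ≤ n) :
    ∃ i j, i + (r + 2) ≤ j ∧ j ≤ i + (2 * r + 2) ∧ j < n ∧ Tight G n w i j := by
  have hex : ∃ L, r + 2 ≤ L ∧ ∃ i, i + L < n ∧ Tight G n w i (i + L) :=
    ⟨n - 1, by omega, 0, by omega, by simpa using h.tight_zero_last (by omega)⟩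
  classical
  obtain ⟨hL, i, hi, ht⟩ := Nat.find_spec hex
  have hmin := fun m => Nat.find_min hex (m := m)
  generalize Nat.find hex = L at hL hi ht hmin
  obtain ⟨k, hik, hkj, h1, h2⟩ := ht.exists_split h (by omega) hi
  refine ⟨i, i + L, by omega, ?_, hi, ht⟩
  by_contra hcon
  rcases Nat.lt_or_ge (k - i) (r + 2) with hlt | hge
  · refine hmin (i + L - k) (by omega) ⟨by omega, k, by omega, ?_⟩
    rwa [show k + (i + L - k) = i + L by omega]
  · refine hmin (k - i) (by omega) ⟨by omega, i, by omega, ?_⟩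
    rwa [show i + (k - i) = k by omega]

/-- No edge crosses the diagonal `ij`. -/
theorem inside_or_outside (h : IsMopEnum G n w) {i j a b : ℕ} (hj : j < n)
    (hadj : G.Adj (w i) (w j)) (hab : a < b) (hb : b < n) (hadj' : G.Adj (w a) (w b)) :
    ((i ≤ a ∧ a ≤ j) ∧ i ≤ b ∧ b ≤ j) ∨ ((a ≤ i ∨ j ≤ a) ∧ (b ≤ i ∨ j ≤ b)) := by
  have h1 := h.noncrossing i j a b
  have h2 := h.noncrossing a b i j
  by_contra hcon
  rcases Nat.lt_or_ge i a with h3 | h3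
  · exact h1 h3 (by omega) (by omega) hb hadj hadj'
  · exact h2 (by omega) (by omega) (by omega) hj hadj' hadj

theorem card_chords_outside (h : IsMopEnum G n w) {i j : ℕ} (hij : i < j) (hj : j < n)
    (ht : Tight G n w i j) :
    (chords G n w (fun a => a ≤ i ∨ j ≤ a)).card = 2 * (n - (j - i) + 1) - 3 := by
  classical
  have hunion : chords G n w (fun a => i ≤ a ∧ a ≤ j) ∪ chords G n w (fun a => a ≤ i ∨ j ≤ a) =
      chords G n w fun _ => True := by
    ext ⟨a, b⟩
    simp only [Finset.mem_union, mem_chords]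
    constructor
    · rintro (⟨h1, h2, h3, -⟩ | ⟨h1, h2, h3, -⟩) <;> exact ⟨h1, h2, h3, trivial, trivial⟩
    · rintro ⟨h1, h2, h3, -⟩
      rcases h.inside_or_outside hj ht.1 h1 h2 h3 with h4 | h4
      · exact Or.inl ⟨h1, h2, h3, h4⟩
      · exact Or.inr ⟨h1, h2, h3, h4⟩
  have hinter : chords G n w (fun a => i ≤ a ∧ a ≤ j) ∩ chords G n w (fun a => a ≤ i ∨ j ≤ a) =
      {(i, j)} := by
    rw [← (chords_pair i j hij hj).1 ht.1]
    ext ⟨a, b⟩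
    simp only [Finset.mem_inter, mem_chords]
    constructor
    · rintro ⟨⟨h1, h2, h3, h4⟩, -, -, -, h5⟩
      exact ⟨h1, h2, h3, by omega, by omega⟩
    · rintro ⟨h1, h2, h3, h4⟩
      exact ⟨⟨h1, h2, h3, by omega, by omega⟩, h1, h2, h3, by omega, by omega⟩
  have hc := Finset.card_union_add_card_inter (chords G n w (fun a => i ≤ a ∧ a ≤ j))
    (chords G n w (fun a => a ≤ i ∨ j ≤ a))
  rw [hunion, hinter, h.card_chords_true, Finset.card_singleton] at hc
  have := ht.2
  omega

theorem isMop_inside (h : IsMopEnum G n w) {i j : ℕ} (hij : i + 2 ≤ j) (hj : j < n)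
    (ht : Tight G n w i j) : IsMop (segmentGraph G n w fun a => i ≤ a ∧ a ≤ j).coe := by
  refine h.isMop_segmentGraph (m := j - i + 1) (by omega) (fun a => i + a)
    (fun a b hab => by dsimp only; omega) (fun a ha => by omega) ?_ ?_ ?_ ?_
  · intro b hb
    exact ⟨fun hb' => ⟨b - i, by omega, by omega⟩, by rintro ⟨a, ha, rfl⟩; omega⟩
  · intro a ha
    exact h.adj_succ (i + a) (by omega)
  · have := ht.1.symm
    simpa [show i + (j - i) = j by omega] using this
  · have := ht.2
    omega

theorem isMop_outside (h : IsMopEnum G n w) {i j : ℕ} (hij : i < j) (hj : j < n)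
    (hlast : j - i + 1 < n) (ht : Tight G n w i j) :
    IsMop (segmentGraph G n w fun a => a ≤ i ∨ j ≤ a).coe := by
  let φ : ℕ → ℕ := fun a => if a ≤ i then a else a + (j - i - 1)
  have hφ1 : ∀ a, a ≤ i → φ a = a := fun a ha => if_pos ha
  have hφ2 : ∀ a, i < a → φ a = a + (j - i - 1) := fun a ha => if_neg (by omega)
  refine h.isMop_segmentGraph (m := n - (j - i) + 1) (by omega) φ ?_ ?_ ?_ ?_ ?_ ?_
  · intro a b hab
    dsimp only [φ]
    split_ifs <;> omega
  · intro a ha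
    dsimp only [φ]
    split_ifs <;> omega
  · intro b hb
    constructor
    · rintro (hbi | hbj)
      · exact ⟨b, by omega, hφ1 b hbi⟩
      · exact ⟨b - (j - i - 1), by omega, by rw [hφ2 _ (by omega)]; omega⟩
    · rintro ⟨a, ha, rfl⟩
      dsimp only [φ]
      split_ifs <;> omega
  · intro a ha
    rcases lt_trichotomy a i with hai | rfl | hai
    · rw [hφ1 a hai.le, hφ1 (a + 1) hai]
      exact h.adj_succ a (by omega)
    · rw [hφ1 a le_rfl, hφ2 (a + 1) (by omega), show a + 1 + (j - a - 1) = j by omega]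
      exact ht.1
    · rw [hφ2 a hai, hφ2 (a + 1) (by omega),
        show a + 1 + (j - i - 1) = a + (j - i - 1) + 1 by omega]
      exact h.adj_succ _ (by omega)
  · rw [hφ1 0 (by omega), hφ2 _ (by omega),
      show n - (j - i) + 1 - 1 + (j - i - 1) = n - 1 by omega]
    exact h.adj_last
  · exact h.card_chords_outside hij hj ht

theorem sup_inside_outside (h : IsMopEnum G n w) {i j : ℕ} (hj : j < n)
    (hadj : G.Adj (w i) (w j)) :
    (segmentGraph G n w fun a => i ≤ a ∧ a ≤ j) ⊔ (segmentGraph G n w fun a => a ≤ i ∨ j ≤ a) =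
      ⊤ := by
  refine SimpleGraph.Subgraph.ext ?_ ?_
  · refine Set.eq_univ_of_forall fun v => ?_
    obtain ⟨a, ha, rfl⟩ := h.surj v
    by_cases hin : i ≤ a ∧ a ≤ j
    · exact Or.inl ((h.mem_segment ha).2 hin)
    · exact Or.inr ((h.mem_segment ha).2 (by omega))
  · ext x y
    obtain ⟨a, ha, rfl⟩ := h.surj x
    obtain ⟨b, hb, rfl⟩ := h.surj y
    rw [SimpleGraph.Subgraph.sup_adj, h.segmentGraph_adj ha hb, h.segmentGraph_adj ha hb,
      SimpleGraph.Subgraph.top_adj]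
    constructor
    · rintro (⟨-, -, h1⟩ | ⟨-, -, h1⟩) <;> exact h1
    · intro hab
      have hne : a ≠ b := by rintro rfl; exact hab.ne rfl
      rcases Nat.lt_or_gt_of_ne hne with hlt | hlt
      · rcases h.inside_or_outside hj hadj hlt hb hab with h1 | h1
        · exact Or.inl ⟨h1.1, h1.2, hab⟩
        · exact Or.inr ⟨h1.1, h1.2, hab⟩
      · rcases h.inside_or_outside hj hadj hlt ha hab.symm with h1 | h1
        · exact Or.inl ⟨h1.2, h1.1, hab⟩
        · exact Or.inr ⟨h1.2, h1.1, hab⟩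

theorem verts_inside_inter_outside (h : IsMopEnum G n w) {i j : ℕ} (hij : i < j) (hj : j < n) :
    (segmentGraph G n w fun a => i ≤ a ∧ a ≤ j).verts ∩
      (segmentGraph G n w fun a => a ≤ i ∨ j ≤ a).verts = {w i, w j} := by
  ext v
  obtain ⟨a, ha, rfl⟩ := h.surj v
  change (w a ∈ segment n w _ ∧ w a ∈ segment n w _) ↔ w a = w i ∨ w a = w j
  rw [h.mem_segment ha, h.mem_segment ha]
  constructor
  · intro h1
    have h2 : a = i ∨ a = j := by omega
    rcases h2 with rfl | rfl
    · exact Or.inl rfl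
    · exact Or.inr rfl
  · rintro (h1 | h1)
    · obtain rfl := h.inj _ _ ha (by omega) h1
      omega
    · obtain rfl := h.inj _ _ ha hj h1
      omega

theorem edgeSet_inside_inter_outside (h : IsMopEnum G n w) {i j : ℕ} (hij : i < j) (hj : j < n)
    (hadj : G.Adj (w i) (w j)) :
    (segmentGraph G n w fun a => i ≤ a ∧ a ≤ j).edgeSet ∩
      (segmentGraph G n w fun a => a ≤ i ∨ j ≤ a).edgeSet = {s(w i, w j)} := by
  ext e
  induction e using Sym2.ind with | h x y =>
  obtain ⟨a, ha, rfl⟩ := h.surj x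
  obtain ⟨b, hb, rfl⟩ := h.surj y
  rw [Set.mem_inter_iff, SimpleGraph.Subgraph.mem_edgeSet, SimpleGraph.Subgraph.mem_edgeSet,
    h.segmentGraph_adj ha hb, h.segmentGraph_adj ha hb, Set.mem_singleton_iff, Sym2.eq_iff]
  constructor
  · rintro ⟨⟨h1, h2, h3⟩, h4, h5, -⟩
    have hne : a ≠ b := by rintro rfl; exact h3.ne rfl
    have h6 : (a = i ∧ b = j) ∨ (a = j ∧ b = i) := by omega
    rcases h6 with ⟨rfl, rfl⟩ | ⟨rfl, rfl⟩
    · exact Or.inl ⟨rfl, rfl⟩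
    · exact Or.inr ⟨rfl, rfl⟩
  · rintro (⟨h1, h2⟩ | ⟨h1, h2⟩)
    · obtain rfl := h.inj _ _ ha (by omega) h1
      obtain rfl := h.inj _ _ hb hj h2
      exact ⟨⟨by omega, by omega, hadj⟩, by omega, by omega, hadj⟩
    · obtain rfl := h.inj _ _ ha hj h1
      obtain rfl := h.inj _ _ hb (by omega) h2
      exact ⟨⟨by omega, by omega, hadj.symm⟩, by omega, by omega, hadj.symm⟩

theorem ncard_hamEdges_inside (h : IsMopEnum G n w) {i j : ℕ} (hij : i + 2 ≤ j) (hj : j < n)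
    (hlast : j - i + 1 < n) :
    {e : Sym2 V | e ∈ (segmentGraph G n w fun a => i ≤ a ∧ a ≤ j).edgeSet ∧
      ∃ a b : V, e = s(a, b) ∧ IsHamEdge G a b}.ncard = j - i := by
  have heq : {e : Sym2 V | e ∈ (segmentGraph G n w fun a => i ≤ a ∧ a ≤ j).edgeSet ∧
      ∃ a b : V, e = s(a, b) ∧ IsHamEdge G a b} =
      (fun k => s(w k, w (k + 1))) '' (Finset.Ico i j : Set ℕ) := by
    ext e
    simp only [Set.mem_ofPred_eq, Set.mem_image, Finset.coe_Ico, Set.mem_Ico]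
    constructor
    · rintro ⟨he, x, y, hxy, hham⟩
      rw [h.edgeSet_segmentGraph] at he
      obtain ⟨⟨a, b⟩, hp, rfl⟩ := he
      obtain ⟨hab, hb, hadj, ⟨h1, -⟩, -, h2⟩ := mem_chords.1 hp
      dsimp only at *
      have hham' : IsHamEdge G (w a) (w b) := by
        rcases Sym2.eq_iff.1 hxy with ⟨h3, h4⟩ | ⟨h3, h4⟩
        · rwa [h3, h4]
        · rw [h3, h4]
          exact hham.symm
      have hba : b = a + 1 := by
        by_contra hne
        exact h.not_isHamEdge (by omega) hb (by omega) hadj hham'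
      exact ⟨a, by omega, by rw [hba]⟩
    · rintro ⟨k, ⟨h1, h2⟩, rfl⟩
      refine ⟨?_, _, _, rfl, h.isHamEdge_succ (by omega) (by omega)⟩
      rw [SimpleGraph.Subgraph.mem_edgeSet, h.segmentGraph_adj (by omega) (by omega)]
      exact ⟨by omega, by omega, h.adj_succ k (by omega)⟩
  rw [heq, Set.InjOn.ncard_image, Set.ncard_coe_finset, Nat.card_Ico]
  intro k hk l hl hkl
  simp only [Finset.coe_Ico, Set.mem_Ico] at hk hl
  rcases Sym2.eq_iff.1 hkl with ⟨h1, -⟩ | ⟨h1, h2⟩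
  · exact h.inj _ _ (by omega) (by omega) h1
  · have := h.inj _ _ (by omega) (by omega) h1
    have := h.inj _ _ (by omega) (by omega) h2
    omega

end IsMopEnum

/-- a mop of order `n ≥ 2r+4` has a diagonal partitioning it into two
mops `G1`, `G2` such that `G1` contains exactly `ℓ` Hamiltonian edges of `G` for
some `r+2 ≤ ℓ ≤ 2r+2`. -/
theorem exists_balanced_diagonal {V : Type*} (r n : ℕ) (G : SimpleGraph V)
    (hG : IsMop G) (hcard : Nat.card V = n) (hn : 2 * r + 4 ≤ n) :
    ∃ u v : V, G.Adj u v ∧ ¬ IsHamEdge G u v ∧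
      ∃ G1 G2 : G.Subgraph, IsMop G1.coe ∧ IsMop G2.coe ∧
        G1 ⊔ G2 = ⊤ ∧
        G1.verts ∩ G2.verts = {u, v} ∧
        G1.edgeSet ∩ G2.edgeSet = {s(u, v)} ∧
        ∃ ℓ : ℕ, r + 2 ≤ ℓ ∧ ℓ ≤ 2 * r + 2 ∧
          {e : Sym2 V | e ∈ G1.edgeSet ∧ ∃ a b : V, e = s(a, b) ∧ IsHamEdge G a b}.ncard = ℓ := by
  obtain ⟨m, hm, σ, hσ⟩ := hG
  obtain rfl : m = n := by rw [← hcard, ← Nat.card_congr σ, Nat.card_fin]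
  obtain ⟨w, -, h⟩ := hσ.exists_isMopEnum (by omega)
  obtain ⟨i, j, hij, hji, hj, ht⟩ := h.exists_tight_balanced hn
  exact ⟨w i, w j, ht.1, h.not_isHamEdge (by omega) hj (by omega) ht.1, _, _,
    h.isMop_inside (by omega) hj ht, h.isMop_outside (by omega) hj (by omega) ht,
    h.sup_inside_outside hj ht.1, h.verts_inside_inter_outside (by omega) hj,
    h.edgeSet_inside_inter_outside (by omega) hj ht.1, j - i, by omega, by omega,
    h.ncard_hamEdges_inside (by omega) hj (by omega)⟩

end MopPaper
end

section
/- If G is a maximal outerplanar graph of order n ≥ 4, then the set of vertices of G of degree 2 is an independent set of G, and this set has size at most n/2. -/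
namespace MopPaper

/-- A noncrossing set of pairs `a < b` from the interval `[l, l + k]` has at most `2 * k - 1`
elements. -/
theorem card_add_one_le_of_noncrossing (k : ℕ) (hk : 1 ≤ k) (l : ℕ) (E : Finset (ℕ × ℕ))
    (hE : ∀ p ∈ E, l ≤ p.1 ∧ p.1 < p.2 ∧ p.2 ≤ l + k)
    (hcross : ∀ p ∈ E, ∀ q ∈ E, ¬ (p.1 < q.1 ∧ q.1 < p.2 ∧ p.2 < q.2)) :
    E.card + 1 ≤ 2 * k := by
  induction k using Nat.strong_induction_on generalizing l E with
  | _ k ih =>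
  rcases hk.eq_or_lt with rfl | hk2
  · have hsub : E ⊆ {(l, l + 1)} := by
      rintro ⟨a, b⟩ hp
      have := hE _ hp
      simp only [Finset.mem_singleton, Prod.mk.injEq]
      simp only at this
      omega
    have := Finset.card_le_card hsub
    simp only [Finset.card_singleton] at this
    omega
  · obtain ⟨m, hlm, hmk, hm⟩ : ∃ m, 1 ≤ m ∧ m < k ∧
        ∀ p ∈ E, p = (l, l + k) ∨ p.2 ≤ l + m ∨ l + m ≤ p.1 := by
      by_cases hex : ∃ m, m < k ∧ (l, l + m) ∈ E
      · obtain ⟨m₀, hm₀k, hm₀⟩ := hex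
        obtain ⟨hmk, hmE⟩ := Nat.findGreatest_spec (P := fun m => m < k ∧ (l, l + m) ∈ E)
          hm₀k.le ⟨hm₀k, hm₀⟩
        have hmax : ∀ j, j < k → (l, l + j) ∈ E →
            j ≤ Nat.findGreatest (fun m => m < k ∧ (l, l + m) ∈ E) k :=
          fun j hj hjE => Nat.le_findGreatest hj.le ⟨hj, hjE⟩
        generalize Nat.findGreatest (fun m => m < k ∧ (l, l + m) ∈ E) k = m at *
        refine ⟨m, ?_, hmk, ?_⟩
        · have := hE _ hmE
          simp only at this
          omega
        · rintro ⟨a, b⟩ hp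
          have h1 := hE _ hp
          have h2 := hcross _ hmE _ hp
          simp only [Prod.mk.injEq] at h1 h2 ⊢
          by_cases ha : a = l
          · subst ha
            by_cases hb : b = a + k
            · simp [hb]
            · obtain ⟨j, rfl⟩ := Nat.exists_eq_add_of_le h1.2.1.le
              have := hmax j (by omega) hp
              omega
          · omega
      · refine ⟨1, le_rfl, hk2, ?_⟩
        rintro ⟨a, b⟩ hp
        have h1 := hE _ hp
        simp only [Prod.mk.injEq] at h1 ⊢
        by_cases ha : a = l
        · subst ha
          by_cases hb : b = a + k
          · simp [hb]
          · obtain ⟨j, rfl⟩ := Nat.exists_eq_add_of_le h1.2.1.le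
            exact absurd ⟨j, by omega, hp⟩ hex
        · omega
    have hleft := ih m hmk hlm l (E.filter fun p => p.2 ≤ l + m)
      (fun p hp => by
        have := hE p (Finset.mem_filter.1 hp).1
        have := (Finset.mem_filter.1 hp).2
        omega)
      (fun p hp q hq => hcross p (Finset.mem_filter.1 hp).1 q (Finset.mem_filter.1 hq).1)
    have hright := ih (k - m) (by omega) (by omega) (l + m) (E.filter fun p => l + m ≤ p.1)
      (fun p hp => by
        have := hE p (Finset.mem_filter.1 hp).1
        have := (Finset.mem_filter.1 hp).2
        omega)
      (fun p hp q hq => hcross p (Finset.mem_filter.1 hp).1 q (Finset.mem_filter.1 hq).1)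
    have hsub : E ⊆ insert (l, l + k)
        ((E.filter fun p => p.2 ≤ l + m) ∪ E.filter fun p => l + m ≤ p.1) := by
      intro p hp
      have := hm p hp
      simp only [Finset.mem_insert, Finset.mem_union, Finset.mem_filter]
      tauto
    have h1 := Finset.card_le_card hsub
    have h2 := Finset.card_insert_le (l, l + k)
      ((E.filter fun p => p.2 ≤ l + m) ∪ E.filter fun p => l + m ≤ p.1)
    have h3 := Finset.card_union_le (E.filter fun p => p.2 ≤ l + m)
      (E.filter fun p => l + m ≤ p.1)
    omega

theorem finNext_val {n : ℕ} (i : Fin n) :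
    (finNext i).val = if i.val + 1 = n then 0 else i.val + 1 := by
  have := i.isLt
  simp only [finNext]
  split_ifs with h
  · simp [h]
  · exact Nat.mod_eq_of_lt (by omega)

theorem finNext_injective {n : ℕ} : Function.Injective (finNext (n := n)) := by
  intro i j h
  have h' := congrArg Fin.val h
  rw [finNext_val, finNext_val] at h'
  apply Fin.ext
  split_ifs at h' <;> omega

theorem finNext_surjective {n : ℕ} : Function.Surjective (finNext (n := n)) :=
  Finite.surjective_of_injective finNext_injective

section Witness

variable {V : Type*} {G : SimpleGraph V} {n : ℕ} {σ : Fin n ≃ V}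

/-- In a mop, every pair of nonadjacent vertices is separated by an edge. -/
theorem MopWitness.exists_crossing (h : MopWitness G n σ) (hn : 3 ≤ n) {a b : Fin n}
    (hab : a < b) (hnadj : ¬ G.Adj (σ a) (σ b)) :
    ∃ c d, G.Adj (σ c) (σ d) ∧ a < c ∧ c < b ∧ (d < a ∨ b < d) := by
  classical
  by_contra! hno
  obtain ⟨-, hcross, hcard⟩ := h
  let P : Finset (Fin n × Fin n) := {p | p.1 < p.2 ∧ G.Adj (σ p.1) (σ p.2)}
  have hedges : Nat.card G.edgeSet ≤ P.card := by
    have hsub : G.edgeSet ⊆ (P.image fun p => s(σ p.1, σ p.2) : Finset (Sym2 V)) := by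
      intro e
      induction e using Sym2.ind with
      | _ x y =>
      intro hxy
      obtain ⟨i, rfl⟩ := σ.surjective x
      obtain ⟨j, rfl⟩ := σ.surjective y
      rw [SimpleGraph.mem_edgeSet] at hxy
      simp only [Finset.coe_image, Set.mem_image]
      have hij : i ≠ j := fun hij => hxy.ne (congrArg σ hij)
      rcases lt_or_gt_of_ne hij with hij | hij
      · exact ⟨(i, j), by simp [P, hij, hxy], rfl⟩
      · exact ⟨(j, i), by simp [P, hij, hxy.symm], Sym2.eq_swap⟩
    rw [Nat.card_coe_set_eq]
    calc G.edgeSet.ncard ≤ _ := Set.ncard_le_ncard hsub (Finset.finite_toSet _)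
      _ = _ := Set.ncard_coe_finset _
      _ ≤ _ := Finset.card_image_le
  let E : Finset (ℕ × ℕ) := (insert (a, b) P).image fun p => (p.1.val, p.2.val)
  have hEcard : E.card = P.card + 1 := by
    rw [Finset.card_image_of_injective, Finset.card_insert_of_notMem]
    · simp [P, hnadj]
    · rintro ⟨i, j⟩ ⟨i', j'⟩ hij
      simpa [Fin.ext_iff] using hij
  have hmem : ∀ p ∈ E, ∃ i j : Fin n, p = (i.val, j.val) ∧ i < j ∧
      (i = a ∧ j = b ∨ G.Adj (σ i) (σ j)) := by
    intro p hp
    obtain ⟨⟨i, j⟩, hij, rfl⟩ := Finset.mem_image.1 hp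
    refine ⟨i, j, rfl, ?_⟩
    rcases Finset.mem_insert.1 hij with hij | hij
    · obtain ⟨rfl, rfl⟩ := Prod.mk.inj hij
      exact ⟨hab, .inl ⟨rfl, rfl⟩⟩
    · have := (Finset.mem_filter.1 hij).2
      exact ⟨this.1, .inr this.2⟩
  have := card_add_one_le_of_noncrossing (n - 1) (by omega) 0 E
    (fun p hp => by
      obtain ⟨i, j, rfl, hij, -⟩ := hmem p hp
      have : i.val < j.val := hij
      have := j.isLt
      simp only
      omega)
    (fun p hp q hq => by
      obtain ⟨i, j, rfl, hij, hp'⟩ := hmem p hp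
      obtain ⟨c, d, rfl, hcd, hq'⟩ := hmem q hq
      simp only [Fin.val_fin_lt]
      rintro ⟨h1, h2, h3⟩
      rcases hp' with ⟨rfl, rfl⟩ | hp' <;> rcases hq' with ⟨rfl, rfl⟩ | hq'
      · exact lt_irrefl _ h1
      · exact absurd h3 (hno c d hq' h1 h2).2.not_gt
      · exact absurd h1 (hno j i hp'.symm h2 h3).1.not_gt
      · exact hcross i j c d hp' hq' ⟨h1, h2, h3⟩)
  omega

/-- The neighbors of a degree-2 vertex of a mop are its two neighbors on the boundary cycle. -/
theorem MopWitness.eq_or_eq_of_mem_deg2set (h : MopWitness G n σ) (hn : 3 ≤ n) {i j k : Fin n}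
    (hj : finNext j = i) (hi : σ i ∈ deg2set G) (hk : G.Adj (σ i) (σ k)) :
    k = finNext i ∨ k = j := by
  have hne : finNext i ≠ j := by
    rintro rfl
    have h1 := congrArg Fin.val hj
    have := i.isLt
    rw [finNext_val, finNext_val] at h1
    split_ifs at h1 <;> omega
  have hncard : (G.neighborSet (σ i)).ncard = 2 := hi
  have hsub : {σ (finNext i), σ j} ⊆ G.neighborSet (σ i) := by
    rintro x (rfl | rfl)
    · exact h.1 i
    · exact hj ▸ (h.1 j).symm
  have heq := Set.eq_of_subset_of_ncard_le hsub
    (by rw [hncard, Set.ncard_pair (σ.injective.ne hne)])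
    (Set.finite_of_ncard_ne_zero (by omega))
  have : σ k ∈ ({σ (finNext i), σ j} : Set V) := heq ▸ hk
  simpa using this

/-- Consecutive vertices on the boundary cycle of a mop of order at least 4 do not both have
degree 2. -/
theorem MopWitness.notMem_deg2set_finNext (h : MopWitness G n σ) (hn : 4 ≤ n) {i : Fin n}
    (hi : σ i ∈ deg2set G) : σ (finNext i) ∉ deg2set G := by
  intro hi'
  obtain ⟨j, hj⟩ := finNext_surjective i
  have hiv := finNext_val i
  have hjv := finNext_val j
  have hiv' := finNext_val (finNext i)
  have hnb : ∀ k, G.Adj (σ i) (σ k) → k.val = (finNext i).val ∨ k.val = j.val := fun k hk => by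
    simpa [Fin.ext_iff] using h.eq_or_eq_of_mem_deg2set (by omega) hj hi hk
  rw [hj] at hjv
  have := i.isLt
  have := j.isLt
  have hnadj : ¬ G.Adj (σ (finNext i)) (σ j) := by
    intro hadj
    have := h.eq_or_eq_of_mem_deg2set (by omega) rfl hi' hadj
    simp only [Fin.ext_iff] at this
    split_ifs at * <;> omega
  have key : ∀ c d, G.Adj (σ c) (σ d) → c.val ≠ (finNext i).val → c.val ≠ j.val →
      d.val ≠ (finNext i).val → d.val ≠ j.val → c.val ≠ i.val ∧ d.val ≠ i.val := by
    intro c d hcd h1 h2 h3 h4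
    constructor <;> intro h5 <;> rw [← Fin.ext_iff] at h5 <;> subst h5
    · have := hnb _ hcd; omega
    · have := hnb _ hcd.symm; omega
  rcases lt_trichotomy j (finNext i) with hlt | heq | hlt
  · obtain ⟨c, d, hcd, h1, h2, h3⟩ := h.exists_crossing (by omega) hlt (fun h' => hnadj h'.symm)
    have := key c d hcd
    simp only [Fin.lt_def] at *
    split_ifs at * <;> omega
  · have := congrArg Fin.val heq
    split_ifs at * <;> omega
  · obtain ⟨c, d, hcd, h1, h2, h3⟩ := h.exists_crossing (by omega) hlt hnadj
    have := key c d hcd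
    simp only [Fin.lt_def] at *
    split_ifs at * <;> omega

end Witness

/-- in a mop of order `n ≥ 4`, the set of degree-2 vertices is an
independent set of size at most `n / 2`. -/
theorem deg2_indep_and_small {V : Type*} (G : SimpleGraph V) (hG : IsMop G)
    (hn : 4 ≤ Nat.card V) :
    (∀ u ∈ deg2set G, ∀ v ∈ deg2set G, u ≠ v → ¬ G.Adj u v) ∧
      ((deg2set G).ncard : ℝ) ≤ (Nat.card V : ℝ) / 2 := by
  obtain ⟨n, hn3, σ, h⟩ := hG
  have hcard : Nat.card V = n := by rw [← Nat.card_congr σ, Nat.card_fin]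
  have : Finite V := Finite.of_equiv _ σ
  have hn4 : 4 ≤ n := hcard ▸ hn
  constructor
  · intro u hu v hv _ hadj
    obtain ⟨i, rfl⟩ := σ.surjective u
    obtain ⟨k, rfl⟩ := σ.surjective v
    obtain ⟨j, hj⟩ := finNext_surjective i
    rcases h.eq_or_eq_of_mem_deg2set hn3 hj hu hadj with rfl | rfl
    · exact h.notMem_deg2set_finNext hn4 hu hv
    · exact h.notMem_deg2set_finNext hn4 hv (hj ▸ hu)
  · have hle : (deg2set G).ncard ≤ (deg2set G)ᶜ.ncard := by
      refine Set.ncard_le_ncard_of_injOn (fun v => σ (finNext (σ.symm v))) ?_ ?_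
      · intro v hv
        exact h.notMem_deg2set_finNext hn4 (by simpa using hv)
      · exact (σ.injective.comp (finNext_injective.comp σ.symm.injective)).injOn
    have hsum := Set.ncard_add_ncard_compl (deg2set G)
    have : (2 * (deg2set G).ncard : ℝ) ≤ Nat.card V := by exact_mod_cast (by omega)
    linarith

end MopPaper
end

section
/- If k ≥ 0 and G is a maximal outerplanar graph of order n ≥ k+4, then the K_{1,k+1}-isolation number satisfies ι_k(G) ≤ n/(k+4). -/
namespace MopPaper

/-- A triangulation of a polygon with vertices `0, …, n - 1` in cyclic order, given by the
adjacency relation (sides and diagonals). The cases `n ≤ 2` are degenerate polygons. -/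
structure IsPolygonTriangulation (n : ℕ) (adj : ℕ → ℕ → Prop) : Prop where
  symm : ∀ {u v}, adj u v → adj v u
  ne : ∀ {u v}, adj u v → u ≠ v
  lt : ∀ {u v}, adj u v → u < n
  succ : ∀ {i}, i + 1 < n → adj i (i + 1)
  root : 2 ≤ n → adj 0 (n - 1)
  noncrossing : ∀ {a b c d}, adj a b → adj c d → ¬ (a < c ∧ c < b ∧ b < d)
  apex : ∀ {a b}, adj a b → a + 2 ≤ b → ∃ c, a < c ∧ c < b ∧ adj a c ∧ adj c b

/-- The vertex `v` lies in the closed neighborhood of `S`. -/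
def Dominated (adj : ℕ → ℕ → Prop) (S : Finset ℕ) (v : ℕ) : Prop :=
  v ∈ S ∨ ∃ u ∈ S, adj u v

open Classical in
/-- The neighbors of `v` outside the closed neighborhood of `S`. -/
noncomputable def residualNbrs (n : ℕ) (adj : ℕ → ℕ → Prop) (S : Finset ℕ) (v : ℕ) : Finset ℕ :=
  (Finset.range n).filter fun u => adj v u ∧ ¬ Dominated adj S u

/-- The map contracting the interval `[a, b]` to the vertex `a` and closing the gap. -/
def collapse (a b i : ℕ) : ℕ := if i ≤ a then i else if i ≤ b then a else i - (b - a)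

/-- The section of `collapse a b` that sends `a` to `a`. -/
def expand (a b i : ℕ) : ℕ := if i ≤ a then i else i + (b - a)

/-- Adjacency after contracting the interval `[a, b]`. -/
def contractAdj (adj : ℕ → ℕ → Prop) (a b x y : ℕ) : Prop :=
  x ≠ y ∧ ∃ u v, adj u v ∧ collapse a b u = x ∧ collapse a b v = y

theorem mem_residualNbrs {n : ℕ} {adj : ℕ → ℕ → Prop} {S : Finset ℕ} {v u : ℕ} :
    u ∈ residualNbrs n adj S v ↔ u < n ∧ adj v u ∧ ¬ Dominated adj S u := by
  simp [residualNbrs]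

theorem expand_collapse {a b u : ℕ} (hab : a < b) (hu : u ≤ a ∨ b < u) :
    expand a b (collapse a b u) = u := by
  unfold collapse expand
  rcases hu with hu | hu
  · simp [hu]
  · rw [if_neg (show ¬ u ≤ a by omega), if_neg (show ¬ u ≤ b by omega), if_neg (by omega)]
    omega

theorem lt_of_collapse_lt {a b u v : ℕ} (hab : a < b) (h : collapse a b u < collapse a b v) :
    u < v := by
  unfold collapse at h
  split_ifs at h <;> omega

namespace IsPolygonTriangulation

variable {n : ℕ} {adj : ℕ → ℕ → Prop}

theorem mem_Icc_of_adj (hT : IsPolygonTriangulation n adj) {a b v u : ℕ} (hab : adj a b)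
    (hav : a < v) (hvb : v < b) (hvu : adj v u) : a ≤ u ∧ u ≤ b := by
  constructor
  · by_contra hu
    exact hT.noncrossing (hT.symm hvu) hab ⟨by omega, hav, hvb⟩
  · by_contra hu
    exact hT.noncrossing hab hvu ⟨hav, hvb, by omega⟩

theorem card_residualNbrs_le_of_inside (hT : IsPolygonTriangulation n adj) {k a b v : ℕ}
    {S : Finset ℕ} (hab : adj a b) (ha : Dominated adj S a) (hb : Dominated adj S b)
    (hlen : b ≤ a + k + 2 ∨ b ≤ a + k + 3 ∧ ∃ w, a < w ∧ w < b ∧ Dominated adj S w)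
    (hav : a < v) (hvb : v < b) (hv : ¬ Dominated adj S v) :
    (residualNbrs n adj S v).card ≤ k := by
  have key : ∀ u ∈ residualNbrs n adj S v, a < u ∧ u < b ∧ u ≠ v := by
    intro u hu
    obtain ⟨-, hvu, hd⟩ := mem_residualNbrs.1 hu
    have := hT.mem_Icc_of_adj hab hav hvb hvu
    have h1 : u ≠ a := by rintro rfl; exact hd ha
    have h2 : u ≠ b := by rintro rfl; exact hd hb
    have h3 := hT.ne hvu
    omega
  rcases hlen with hlen | ⟨hlen, w, haw, hwb, hw⟩
  · have hsub : residualNbrs n adj S v ⊆ (Finset.Ioo a b).erase v := by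
      intro u hu
      obtain ⟨h1, h2, h3⟩ := key u hu
      simp [h1, h2, h3]
    have := Finset.card_le_card hsub
    rw [Finset.card_erase_of_mem (by simp [hav, hvb]), Nat.card_Ioo] at this
    omega
  · have hwv : w ≠ v := by rintro rfl; exact hv hw
    have hsub : residualNbrs n adj S v ⊆ ((Finset.Ioo a b).erase v).erase w := by
      intro u hu
      obtain ⟨h1, h2, h3⟩ := key u hu
      have h4 : u ≠ w := by rintro rfl; exact (mem_residualNbrs.1 hu).2.2 hw
      simp [h1, h2, h3, h4]
    have := Finset.card_le_card hsub
    rw [Finset.card_erase_of_mem (by simp [haw, hwb, hwv]),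
      Finset.card_erase_of_mem (by simp [hav, hvb]), Nat.card_Ioo] at this
    omega

theorem card_residualNbrs_le_of_outside (hT : IsPolygonTriangulation n adj) {k a b v : ℕ}
    {S : Finset ℕ} (hab : adj a b) (hlt : a < b) (ha : Dominated adj S a)
    (hb : Dominated adj S b)
    (hlen : n ≤ b - a + k + 2 ∨
      n ≤ b - a + k + 3 ∧ ∃ w, w < n ∧ (w < a ∨ b < w) ∧ Dominated adj S w)
    (hvn : v < n) (hout : v < a ∨ b < v) (hv : ¬ Dominated adj S v) :
    (residualNbrs n adj S v).card ≤ k := by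
  have hbn := hT.lt (hT.symm hab)
  have key : ∀ u ∈ residualNbrs n adj S v, u < n ∧ (a ≤ u → b < u) ∧ u ≠ v := by
    intro u hu
    obtain ⟨hun, hvu, hd⟩ := mem_residualNbrs.1 hu
    have h1 : u ≠ a := by rintro rfl; exact hd ha
    have h2 : u ≠ b := by rintro rfl; exact hd hb
    refine ⟨hun, fun hau => ?_, (hT.ne hvu).symm⟩
    by_contra hub
    have := hT.mem_Icc_of_adj hab (by omega) (by omega) (hT.symm hvu)
    omega
  have hcard : (Finset.range n \ Finset.Icc a b).card = n - (b + 1 - a) := by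
    rw [Finset.card_sdiff_of_subset, Finset.card_range, Nat.card_Icc]
    intro u hu
    simp only [Finset.mem_Icc, Finset.mem_range] at hu ⊢
    omega
  have hvmem : v ∈ Finset.range n \ Finset.Icc a b := by
    simp only [Finset.mem_sdiff, Finset.mem_Icc, Finset.mem_range]
    omega
  rcases hlen with hlen | ⟨hlen, w, hwn, hwout, hw⟩
  · have hsub : residualNbrs n adj S v ⊆ (Finset.range n \ Finset.Icc a b).erase v := by
      intro u hu
      have := key u hu
      simp only [Finset.mem_erase, Finset.mem_sdiff, Finset.mem_Icc, Finset.mem_range]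
      omega
    have := Finset.card_le_card hsub
    rw [Finset.card_erase_of_mem hvmem, hcard] at this
    omega
  · have hwv : w ≠ v := by rintro rfl; exact hv hw
    have hsub : residualNbrs n adj S v ⊆
        ((Finset.range n \ Finset.Icc a b).erase v).erase w := by
      intro u hu
      have := key u hu
      have h4 : u ≠ w := by rintro rfl; exact (mem_residualNbrs.1 hu).2.2 hw
      simp only [Finset.mem_erase, Finset.mem_sdiff, Finset.mem_Icc, Finset.mem_range]
      omega
    have := Finset.card_le_card hsub
    rw [Finset.card_erase_of_mem, Finset.card_erase_of_mem hvmem, hcard] at this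
    · omega
    · simp only [Finset.mem_erase, Finset.mem_sdiff, Finset.mem_Icc, Finset.mem_range]
      omega

/-- A shortest edge of length at least `m` spans a triangle whose other two sides are shorter
than `m`. -/
theorem exists_minimal_triangle (hT : IsPolygonTriangulation n adj) {m : ℕ} (hm : 2 ≤ m)
    (hmn : m + 1 ≤ n) :
    ∃ a c b, a < c ∧ c < b ∧ adj a b ∧ adj a c ∧ adj c b ∧ a + m ≤ b ∧ c < a + m ∧
      b < c + m := by
  classical
  have hex : ∃ l, m ≤ l ∧ ∃ a, adj a (a + l) :=
    ⟨n - 1, by omega, 0, by simpa using hT.root (by omega)⟩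
  obtain ⟨hml, a, hadj⟩ := Nat.find_spec hex
  have hmin := fun l (hl : l < Nat.find hex) => Nat.find_min hex hl
  set l := Nat.find hex
  obtain ⟨c, hac, hcl, h1, h2⟩ := hT.apex hadj (by omega)
  refine ⟨a, c, a + l, hac, hcl, hadj, h1, h2, by omega, ?_, ?_⟩
  · by_contra hc
    exact hmin (c - a) (by omega) ⟨by omega, a, by rwa [show a + (c - a) = c by omega]⟩
  · by_contra hc
    exact hmin (a + l - c) (by omega)
      ⟨by omega, c, by rwa [show c + (a + l - c) = a + l by omega]⟩

theorem contract (hT : IsPolygonTriangulation n adj) {a b : ℕ} (hab : adj a b) (hlt : a < b) :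
    IsPolygonTriangulation (n - (b - a)) (contractAdj adj a b) where
  symm := by
    rintro x y ⟨hne, u, v, huv, hu, hv⟩
    exact ⟨hne.symm, v, u, hT.symm huv, hv, hu⟩
  ne h := h.1
  lt := by
    rintro x y ⟨-, u, v, huv, rfl, -⟩
    have h1 := hT.lt huv
    have h2 := hT.lt (hT.symm hab)
    unfold collapse
    split_ifs <;> omega
  succ := by
    intro i hi
    refine ⟨by omega, ?_⟩
    by_cases hia : i < a
    · refine ⟨i, i + 1, hT.succ (by omega), ?_, ?_⟩ <;> unfold collapse <;> split_ifs <;> omega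
    · refine ⟨i + (b - a), i + (b - a) + 1, hT.succ (by omega), ?_, ?_⟩ <;> unfold collapse <;>
        split_ifs <;> omega
  root := by
    intro h2
    have hb := hT.lt (hT.symm hab)
    refine ⟨by omega, 0, n - 1, hT.root (by omega), ?_, ?_⟩ <;> unfold collapse <;>
      split_ifs <;> omega
  noncrossing := by
    rintro _ _ _ _ ⟨-, u, v, huv, rfl, rfl⟩ ⟨-, s, t, hst, rfl, rfl⟩ ⟨h1, h2, h3⟩
    exact hT.noncrossing huv hst
      ⟨lt_of_collapse_lt hlt h1, lt_of_collapse_lt hlt h2, lt_of_collapse_lt hlt h3⟩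
  apex := by
    rintro _ _ ⟨-, u, v, huv, rfl, rfl⟩ hlen
    induction hd : v - u using Nat.strong_induction_on generalizing u v with
    | _ d ih =>
      have huv' : u < v := lt_of_collapse_lt hlt (by omega)
      have hu2 : u + 2 ≤ v := by
        unfold collapse at hlen
        split_ifs at hlen <;> omega
      have hout : ¬ (a < u ∧ u < b) ∧ ¬ (a < v ∧ v < b) := by
        constructor
        · rintro ⟨h1, h2⟩
          have := hT.mem_Icc_of_adj hab h1 h2 huv
          unfold collapse at hlen
          split_ifs at hlen <;> omega
        · rintro ⟨h1, h2⟩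
          have := hT.mem_Icc_of_adj hab h1 h2 (hT.symm huv)
          unfold collapse at hlen
          split_ifs at hlen <;> omega
      obtain ⟨c, huc, hcv, h1, h2⟩ := hT.apex huv hu2
      have hc : ¬ (a < c ∧ c < b) ∨ (a ≤ u ∧ v ≤ b) := by
        by_contra! hcon
        have h3 := hT.mem_Icc_of_adj hab hcon.1.1 hcon.1.2 (hT.symm h1)
        have h4 := hT.mem_Icc_of_adj hab hcon.1.1 hcon.1.2 h2
        omega
      by_cases h3 : collapse a b u = collapse a b c
      · obtain ⟨e, he⟩ := ih (v - c) (by omega) c v h2 (h3 ▸ hlen) rfl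
        exact ⟨e, h3 ▸ he⟩
      by_cases h4 : collapse a b c = collapse a b v
      · obtain ⟨e, he⟩ := ih (c - u) (by omega) u c h1 (h4 ▸ hlen) rfl
        exact ⟨e, h4 ▸ he⟩
      have mono : ∀ {x y}, x < y → collapse a b x ≠ collapse a b y →
          collapse a b x < collapse a b y := fun hxy hne => by
        by_contra hcon
        have := lt_of_collapse_lt hlt (lt_of_le_of_ne (not_lt.1 hcon) hne.symm)
        omega
      exact ⟨collapse a b c, mono huc h3, mono hcv h4, ⟨h3, u, c, h1, rfl, rfl⟩,
        ⟨h4, c, v, h2, rfl, rfl⟩⟩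

theorem exists_isolating_of_le (hT : IsPolygonTriangulation n adj) {k : ℕ} (hn : 1 ≤ n)
    (hnk : n ≤ 2 * k + 7) :
    ∃ S : Finset ℕ, S.card ≤ 1 ∧
      ∀ v < n, ¬ Dominated adj S v → (residualNbrs n adj S v).card ≤ k := by
  obtain hn2 | hn3 : n ≤ 2 ∨ 3 ≤ n := by omega
  · refine ⟨{0}, by simp, fun v hv hd => ?_⟩
    have h0 : v ≠ 0 := by rintro rfl; exact hd (Or.inl (by simp))
    exact absurd (Or.inr ⟨0, by simp, by
      simpa [show v = 1 by omega] using hT.succ (i := 0) (by omega)⟩) hd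
  obtain ⟨a, c, b, hac, hcb, hab, h1, h2, hl, hl1, hl2⟩ :=
    hT.exists_minimal_triangle (m := (n + 1) / 2) (by omega) (by omega)
  have hbn := hT.lt (hT.symm hab)
  have dom : ∀ {x y}, x = y ∨ adj x y → Dominated adj {x} y := by
    rintro x y (rfl | h)
    · exact Or.inl (by simp)
    · exact Or.inr ⟨x, by simp, h⟩
  have cover : ∀ x, x = a ∨ x = b ∨ x = c →
      (c ≤ a + k + 2 ∨ ∃ w, a < w ∧ w < c ∧ adj x w) →
      (b ≤ c + k + 2 ∨ ∃ w, c < w ∧ w < b ∧ adj x w) →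
      (n ≤ b - a + k + 2 ∨ ∃ w, w < n ∧ (w < a ∨ b < w) ∧ adj x w) →
      ∃ S : Finset ℕ, S.card ≤ 1 ∧
        ∀ v < n, ¬ Dominated adj S v → (residualNbrs n adj S v).card ≤ k := by
    intro x hx hA hB hC
    have da : Dominated adj {x} a := dom <| by
      rcases hx with rfl | rfl | rfl
      exacts [Or.inl rfl, Or.inr (hT.symm hab), Or.inr (hT.symm h1)]
    have db : Dominated adj {x} b := dom <| by
      rcases hx with rfl | rfl | rfl
      exacts [Or.inr hab, Or.inl rfl, Or.inr h2]
    have dc : Dominated adj {x} c := dom <| by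
      rcases hx with rfl | rfl | rfl
      exacts [Or.inr h1, Or.inr (hT.symm h2), Or.inl rfl]
    refine ⟨{x}, by simp, fun v hv hd => ?_⟩
    have hva : v ≠ a := by rintro rfl; exact hd da
    have hvb : v ≠ b := by rintro rfl; exact hd db
    have hvc : v ≠ c := by rintro rfl; exact hd dc
    obtain hv1 | hv1 | hv1 : (a < v ∧ v < c) ∨ (c < v ∧ v < b) ∨ (v < a ∨ b < v) := by omega
    · exact hT.card_residualNbrs_le_of_inside h1 da dc
        (hA.imp_right fun ⟨w, hw1, hw2, hw⟩ => ⟨by omega, w, hw1, hw2, dom (Or.inr hw)⟩)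
        hv1.1 hv1.2 hd
    · exact hT.card_residualNbrs_le_of_inside h2 dc db
        (hB.imp_right fun ⟨w, hw1, hw2, hw⟩ => ⟨by omega, w, hw1, hw2, dom (Or.inr hw)⟩)
        hv1.1 hv1.2 hd
    · exact hT.card_residualNbrs_le_of_outside hab (by omega) da db
        (hC.imp_right fun ⟨w, hw1, hw2, hw⟩ => ⟨by omega, w, hw1, hw2, dom (Or.inr hw)⟩)
        hv hv1 hd
  have succ' : ∀ {i}, i + 1 < n → adj (i + 1) i := fun h => hT.symm (hT.succ h)
  have pred : ∀ {i}, 0 < i → i < n → adj i (i - 1) := fun {i} h0 hi => by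
    obtain ⟨j, rfl⟩ := Nat.exists_eq_succ_of_ne_zero h0.ne'
    exact succ' hi
  by_cases hC : n ≤ b - a + k + 2
  · refine cover c (by simp) ?_ ?_ (Or.inl hC)
    · by_cases h : c ≤ a + k + 2
      · exact Or.inl h
      · exact Or.inr ⟨c - 1, by omega, by omega, pred (by omega) (by omega)⟩
    · by_cases h : b ≤ c + k + 2
      · exact Or.inl h
      · exact Or.inr ⟨c + 1, by omega, by omega, hT.succ (by omega)⟩
  by_cases hA : c ≤ a + k + 2
  · refine cover b (by simp) (Or.inl hA) ?_ (Or.inr ?_)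
    · by_cases h : b ≤ c + k + 2
      · exact Or.inl h
      · exact Or.inr ⟨b - 1, by omega, by omega, pred (by omega) (by omega)⟩
    · by_cases h : b + 1 < n
      · exact ⟨b + 1, h, by omega, hT.succ h⟩
      · refine ⟨0, by omega, by omega, hT.symm ?_⟩
        rw [show b = n - 1 by omega]
        exact hT.root (by omega)
  · refine cover a (by simp) (Or.inr ⟨a + 1, by omega, by omega, hT.succ (by omega)⟩)
      (Or.inl (by omega)) (Or.inr ?_)
    obtain rfl | h := Nat.eq_zero_or_pos a
    · exact ⟨n - 1, by omega, by omega, hT.root (by omega)⟩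
    · exact ⟨a - 1, by omega, by omega, pred h (by omega)⟩

theorem exists_isolating_step (hT : IsPolygonTriangulation n adj) {k a b c : ℕ}
    (hac : a < c) (hcb : c < b) (hab : adj a b) (h1 : adj a c) (h2 : adj c b)
    (hl1 : c < a + (k + 4)) (hl2 : b < c + (k + 4)) {S' : Finset ℕ}
    (hS' : ∀ v < n - (b - a), ¬ Dominated (contractAdj adj a b) S' v →
      (residualNbrs (n - (b - a)) (contractAdj adj a b) S' v).card ≤ k) :
    ∃ S : Finset ℕ, S.card ≤ S'.card + 1 ∧
      ∀ v < n, ¬ Dominated adj S v → (residualNbrs n adj S v).card ≤ k := by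
  classical
  have hlt : a < b := hac.trans hcb
  have hbn := hT.lt (hT.symm hab)
  set z := if a ∈ S' then b else c with hz
  set S := insert z (S'.image (expand a b))
  have hzS : z ∈ S := Finset.mem_insert_self _ _
  have hexp : ∀ s ∈ S', expand a b s ∈ S := fun s hs =>
    Finset.mem_insert_of_mem (Finset.mem_image_of_mem _ hs)
  have haS : a ∈ S' → a ∈ S := fun ha => by simpa [expand] using hexp a ha
  have dom : ∀ {x y}, x ∈ S → adj x y → Dominated adj S y := fun hx h => Or.inr ⟨_, hx, h⟩
  obtain ⟨da, db, dc, dA, dB⟩ : Dominated adj S a ∧ Dominated adj S b ∧ Dominated adj S c ∧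
      (a + 1 < c → ∃ w, a < w ∧ w < c ∧ Dominated adj S w) ∧
      (c + 1 < b → ∃ w, c < w ∧ w < b ∧ Dominated adj S w) := by
    by_cases ha : a ∈ S'
    · have hbS : b ∈ S := by simpa [hz, ha] using hzS
      refine ⟨Or.inl (haS ha), Or.inl hbS, dom hbS (hT.symm h2),
        fun h => ⟨a + 1, by omega, h, dom (haS ha) (hT.succ (by omega))⟩,
        fun h => ⟨b - 1, by omega, by omega, dom hbS (hT.symm ?_)⟩⟩
      have := hT.succ (i := b - 1) (by omega)
      rwa [show b - 1 + 1 = b by omega] at this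
    · have hcS : c ∈ S := by simpa [hz, ha] using hzS
      refine ⟨dom hcS (hT.symm h1), dom hcS h2, Or.inl hcS,
        fun h => ⟨c - 1, by omega, by omega, dom hcS (hT.symm ?_)⟩,
        fun h => ⟨c + 1, by omega, by omega, dom hcS (hT.succ (by omega))⟩⟩
      have := hT.succ (i := c - 1) (by omega)
      rwa [show c - 1 + 1 = c by omega] at this
  have hlift : ∀ u, u < a ∨ b < u → ¬ Dominated adj S u →
      ¬ Dominated (contractAdj adj a b) S' (collapse a b u) := by
    rintro u hu hd (hmem | ⟨s, hs, -, s', u', hadj, rfl, hu'⟩)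
    · have := hexp _ hmem
      rw [expand_collapse hlt (by omega)] at this
      exact hd (Or.inl this)
    · obtain rfl : u' = u := by
        unfold collapse at hu'
        split_ifs at hu' <;> omega
      by_cases hin : a ≤ s' ∧ s' ≤ b
      · have hsa : collapse a b s' = a := by
          unfold collapse
          split_ifs <;> omega
        rw [hsa] at hs
        have hbS : b ∈ S := by simpa [hz, hs] using hzS
        by_cases hint : a < s' ∧ s' < b
        · have := hT.mem_Icc_of_adj hab hint.1 hint.2 hadj
          omega
        · obtain rfl | rfl : s' = a ∨ s' = b := by omega
          · exact hd (dom (haS hs) hadj)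
          · exact hd (dom hbS hadj)
      · have := hexp _ hs
        rw [expand_collapse hlt (by omega)] at this
        exact hd (dom this hadj)
  refine ⟨S, (Finset.card_insert_le _ _).trans (Nat.succ_le_succ Finset.card_image_le),
    fun v hv hd => ?_⟩
  have hva : v ≠ a := by rintro rfl; exact hd da
  have hvb : v ≠ b := by rintro rfl; exact hd db
  have hvc : v ≠ c := by rintro rfl; exact hd dc
  obtain hv1 | hv1 | hv1 : (a < v ∧ v < c) ∨ (c < v ∧ v < b) ∨ (v < a ∨ b < v) := by omega
  · exact hT.card_residualNbrs_le_of_inside h1 da dc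
      (Or.inr ⟨by omega, dA (by omega)⟩) hv1.1 hv1.2 hd
  · exact hT.card_residualNbrs_le_of_inside h2 dc db
      (Or.inr ⟨by omega, dB (by omega)⟩) hv1.1 hv1.2 hd
  have hcol : ∀ u < n, u < a ∨ b < u → collapse a b u < n - (b - a) := by
    intro u hun hu
    unfold collapse
    split_ifs <;> omega
  have hout : ∀ u ∈ residualNbrs n adj S v, u < a ∨ b < u := by
    intro u hu
    obtain ⟨-, hvu, hdu⟩ := mem_residualNbrs.1 hu
    have hua : u ≠ a := by rintro rfl; exact hdu da
    have hub : u ≠ b := by rintro rfl; exact hdu db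
    by_contra hin
    have := hT.mem_Icc_of_adj hab (by omega) (by omega) (hT.symm hvu)
    omega
  refine le_trans ?_ (hS' (collapse a b v) (hcol v hv hv1) (hlift v hv1 hd))
  refine Finset.card_le_card_of_injOn (collapse a b) (fun u hu => ?_) (fun u hu w hw huw => ?_)
  · have hu' := hout u hu
    obtain ⟨hun, hvu, hdu⟩ := mem_residualNbrs.1 hu
    refine mem_residualNbrs.2 ⟨hcol u hun hu', ⟨fun heq => hT.ne hvu ?_, v, u, hvu, rfl, rfl⟩,
      hlift u hu' hdu⟩
    rw [← expand_collapse (a := a) (b := b) (u := v) hlt (by omega), heq,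
      expand_collapse hlt (by omega)]
  · have hu' := hout u hu
    have hw' := hout w hw
    rw [← expand_collapse (a := a) (b := b) (u := u) hlt (by omega), huw,
      expand_collapse hlt (by omega)]

theorem exists_isolating {n : ℕ} {adj : ℕ → ℕ → Prop} (hT : IsPolygonTriangulation n adj)
    (k : ℕ) (hn : 1 ≤ n) :
    ∃ S : Finset ℕ, S.card ≤ max 1 (n / (k + 4)) ∧
      ∀ v < n, ¬ Dominated adj S v → (residualNbrs n adj S v).card ≤ k := by
  induction n using Nat.strong_induction_on generalizing adj with
  | _ n ih =>
    by_cases hnk : n ≤ 2 * k + 7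
    · obtain ⟨S, hS, h⟩ := hT.exists_isolating_of_le hn hnk
      exact ⟨S, hS.trans (le_max_left _ _), h⟩
    obtain ⟨a, c, b, hac, hcb, hab, h1, h2, hl, hl1, hl2⟩ :=
      hT.exists_minimal_triangle (m := k + 4) (by omega) (by omega)
    obtain ⟨S', hcard, hS'⟩ := ih (n - (b - a)) (by omega)
      (hT.contract hab (by omega)) (by omega)
    obtain ⟨S, hSS', hS⟩ := hT.exists_isolating_step hac hcb hab h1 h2 hl1 hl2 hS'
    refine ⟨S, ?_, hS⟩
    have hdiv : (n - (b - a)) / (k + 4) + 1 ≤ n / (k + 4) := by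
      rw [← Nat.add_div_right _ (by omega)]
      exact Nat.div_le_div_right (by omega)
    have htwo : 2 ≤ n / (k + 4) := (Nat.le_div_iff_mul_le (by omega)).2 (by omega)
    omega

end IsPolygonTriangulation

/-- A noncrossing set of chords and sides of a convex polygon on `b - a + 1` points has at most
`2 (b - a) - 1` elements. -/
theorem card_noncrossing_le (E : Finset (ℕ × ℕ)) (hlt : ∀ e ∈ E, e.1 < e.2)
    (hE : ∀ e ∈ E, ∀ e' ∈ E, ¬ (e.1 < e'.1 ∧ e'.1 < e.2 ∧ e.2 < e'.2)) {a b : ℕ} (hab : a < b) :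
    (E.filter fun e => a ≤ e.1 ∧ e.2 ≤ b).card + 1 ≤ 2 * (b - a) := by
  classical
  induction hd : b - a using Nat.strong_induction_on generalizing a b with
  | _ d ih =>
    by_cases h1 : b = a + 1
    · have : (E.filter fun e => a ≤ e.1 ∧ e.2 ≤ b) ⊆ {(a, b)} := by
        rintro ⟨i, j⟩ he
        obtain ⟨heE, h2, h3⟩ := Finset.mem_filter.1 he
        have := hlt _ heE
        simp only [Finset.mem_singleton, Prod.mk.injEq] at this ⊢
        omega
      have := Finset.card_le_card this
      rw [Finset.card_singleton] at this
      omega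
    by_cases hex : ∃ c, a < c ∧ c < b ∧ (a, c) ∈ E
    · obtain ⟨c, hc, hmax⟩ : ∃ c, (a < c ∧ c < b ∧ (a, c) ∈ E) ∧
          ∀ c', a < c' ∧ c' < b ∧ (a, c') ∈ E → c' ≤ c := by
        obtain ⟨c₀, hc₀⟩ := hex
        refine ⟨_, Nat.findGreatest_spec (P := fun c => a < c ∧ c < b ∧ (a, c) ∈ E)
          (n := b) hc₀.2.1.le hc₀, fun c' hc' => Nat.le_findGreatest hc'.2.1.le hc'⟩
      have hsub : (E.filter fun e => a ≤ e.1 ∧ e.2 ≤ b) ⊆ insert (a, b)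
          ((E.filter fun e => a ≤ e.1 ∧ e.2 ≤ c) ∪ (E.filter fun e => c ≤ e.1 ∧ e.2 ≤ b)) := by
        rintro ⟨i, j⟩ he
        obtain ⟨heE, h2, h3⟩ := Finset.mem_filter.1 he
        have h4 := hlt _ heE
        have h5 := hE _ hc.2.2 _ heE
        have h6 : i = a → j = b ∨ j ≤ c := by
          rintro rfl
          by_contra! hcon
          have := hmax j ⟨h4, lt_of_le_of_ne h3 hcon.1, heE⟩
          omega
        simp only [Finset.mem_insert, Finset.mem_union, Finset.mem_filter, heE, true_and,
          Prod.mk.injEq] at *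
        omega
      have hcard := (Finset.card_le_card hsub).trans ((Finset.card_insert_le _ _).trans
        (Nat.succ_le_succ (Finset.card_union_le _ _)))
      have h2 := ih (c - a) (by omega) hc.1 rfl
      have h3 := ih (b - c) (by omega) hc.2.1 rfl
      omega
    · have hsub : (E.filter fun e => a ≤ e.1 ∧ e.2 ≤ b) ⊆ insert (a, b)
          (E.filter fun e => a + 1 ≤ e.1 ∧ e.2 ≤ b) := by
        rintro ⟨i, j⟩ he
        obtain ⟨heE, h2, h3⟩ := Finset.mem_filter.1 he
        have h4 := hlt _ heE
        have h6 : i = a → j = b := by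
          rintro rfl
          by_contra hcon
          exact hex ⟨j, h4, lt_of_le_of_ne h3 hcon, heE⟩
        simp only [Finset.mem_insert, Finset.mem_filter, heE, true_and, Prod.mk.injEq] at *
        omega
      have hcard := (Finset.card_le_card hsub).trans (Finset.card_insert_le _ _)
      have h2 := ih (b - (a + 1)) (by omega) (a := a + 1) (by omega) rfl
      omega

/-- A noncrossing set of sides and chords of a convex `n`-gon that contains all sides and has
`2 n - 3` elements is a triangulation. -/
theorem exists_apex_of_card {n : ℕ} (E : Finset (ℕ × ℕ)) (hlt : ∀ e ∈ E, e.1 < e.2 ∧ e.2 < n)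
    (hE : ∀ e ∈ E, ∀ e' ∈ E, ¬ (e.1 < e'.1 ∧ e'.1 < e.2 ∧ e.2 < e'.2))
    (hcard : 2 * n - 3 ≤ E.card) (hsucc : ∀ i, i + 1 < n → (i, i + 1) ∈ E) {a b : ℕ}
    (hab : (a, b) ∈ E) (hlen : a + 2 ≤ b) :
    ∃ c, a < c ∧ c < b ∧ (a, c) ∈ E ∧ (c, b) ∈ E := by
  classical
  have hbn := (hlt _ hab).2
  simp only at hbn
  obtain ⟨c, hc, hmax⟩ : ∃ c, (a < c ∧ c < b ∧ (a, c) ∈ E) ∧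
      ∀ c', a < c' ∧ c' < b ∧ (a, c') ∈ E → c' ≤ c := by
    refine ⟨_, Nat.findGreatest_spec (P := fun c => a < c ∧ c < b ∧ (a, c) ∈ E)
      (n := b) (m := a + 1) (by omega) ⟨by omega, by omega, hsucc a (by omega)⟩,
      fun c' hc' => Nat.le_findGreatest hc'.2.1.le hc'⟩
  refine ⟨c, hc.1, hc.2.1, hc.2.2, ?_⟩
  by_contra hcb
  have hnew : ∀ e ∈ E, ¬ (e.1 < c ∧ c < e.2 ∧ e.2 < b) ∧ ¬ (c < e.1 ∧ e.1 < b ∧ b < e.2) := by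
    rintro ⟨i, j⟩ he
    have h1 := hE _ he _ hab
    have h2 := hE _ hab _ he
    have h3 := hE _ hc.2.2 _ he
    have h4 : i = a → j < b → a < j → j ≤ c := by
      rintro rfl hj hij
      exact hmax j ⟨hij, hj, he⟩
    simp only at *
    omega
  have hlt' : ∀ e ∈ insert (c, b) E, e.1 < e.2 ∧ e.2 < n := by
    intro e he
    obtain rfl | he := Finset.mem_insert.1 he
    · exact ⟨hc.2.1, hbn⟩
    · exact hlt e he
  have hbound := card_noncrossing_le (insert (c, b) E) (fun e he => (hlt' e he).1) (by
    intro e he e' he'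
    obtain rfl | he := Finset.mem_insert.1 he <;> obtain rfl | he' := Finset.mem_insert.1 he'
    · simp
    · exact (hnew e' he').2
    · exact (hnew e he).1
    · exact hE e he e' he') (a := 0) (b := n - 1) (by omega)
  rw [Finset.filter_true_of_mem, Finset.card_insert_of_notMem hcb] at hbound
  · omega
  · intro e he
    have := hlt' e he
    omega

/-- Indexing the vertices along a witnessing cyclic order turns a mop into a polygon
triangulation. -/
theorem MopWitness.isPolygonTriangulation {V : Type*} {G : SimpleGraph V} {n : ℕ} (hn : 3 ≤ n)
    {σ : Fin n ≃ V} (h : MopWitness G n σ) :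
    IsPolygonTriangulation n fun i j =>
      ∃ (hi : i < n) (hj : j < n), G.Adj (σ ⟨i, hi⟩) (σ ⟨j, hj⟩) := by
  classical
  obtain ⟨hcyc, hnc, hcard⟩ := h
  set adj : ℕ → ℕ → Prop := fun i j =>
    ∃ (hi : i < n) (hj : j < n), G.Adj (σ ⟨i, hi⟩) (σ ⟨j, hj⟩)
  have hsymm : ∀ {u v}, adj u v → adj v u := fun ⟨hu, hv, huv⟩ => ⟨hv, hu, huv.symm⟩
  have hsucc : ∀ {i}, i + 1 < n → adj i (i + 1) := fun {i} hi => by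
    have := hcyc ⟨i, by omega⟩
    simp only [finNext, Nat.mod_eq_of_lt hi] at this
    exact ⟨by omega, hi, this⟩
  have hncr : ∀ {a b c d}, adj a b → adj c d → ¬ (a < c ∧ c < b ∧ b < d) :=
    fun ⟨ha, hb, hab⟩ ⟨hc, hd, hcd⟩ => hnc ⟨_, ha⟩ ⟨_, hb⟩ ⟨_, hc⟩ ⟨_, hd⟩ hab hcd
  refine ⟨hsymm, ?_, fun ⟨hu, _⟩ => hu, hsucc, fun _ => ?_, hncr, fun {a b} hab hlen => ?_⟩
  · rintro u v ⟨hu, hv, huv⟩ rfl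
    exact G.loopless.irrefl _ huv
  · have := hcyc ⟨n - 1, by omega⟩
    simp only [finNext, show n - 1 + 1 = n by omega, Nat.mod_self] at this
    exact ⟨by omega, by omega, this.symm⟩
  set E := (Finset.range n ×ˢ Finset.range n).filter fun e => e.1 < e.2 ∧ adj e.1 e.2 with hEdef
  have hmem : ∀ {i j}, (i, j) ∈ E ↔ i < j ∧ adj i j := by
    intro i j
    simp only [hEdef, Finset.mem_filter, Finset.mem_product, Finset.mem_range]
    exact ⟨fun h => h.2, fun h => ⟨⟨h.2.1, h.2.2.1⟩, h⟩⟩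
  have hEcard : 2 * n - 3 ≤ E.card := by
    rw [← hcard]
    let f : ℕ × ℕ → Sym2 V := fun e =>
      s(σ ⟨e.1 % n, Nat.mod_lt _ (by omega)⟩, σ ⟨e.2 % n, Nat.mod_lt _ (by omega)⟩)
    have hsub : G.edgeSet ⊆ (E.image f : Finset (Sym2 V)) := by
      intro e he
      induction e using Sym2.ind with
      | _ x y =>
        obtain ⟨i, rfl⟩ := σ.surjective x
        obtain ⟨j, rfl⟩ := σ.surjective y
        rw [SimpleGraph.mem_edgeSet] at he
        rw [Finset.mem_coe, Finset.mem_image]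
        have hne : i.val ≠ j.val := fun hij => he.ne (by rw [Fin.ext hij])
        rcases lt_or_gt_of_ne hne with hij | hij
        · exact ⟨(i, j), hmem.2 ⟨hij, i.2, j.2, he⟩, by
            simp [f, Nat.mod_eq_of_lt i.2, Nat.mod_eq_of_lt j.2]⟩
        · exact ⟨(j, i), hmem.2 ⟨hij, j.2, i.2, he.symm⟩, by
            simp [f, Nat.mod_eq_of_lt i.2, Nat.mod_eq_of_lt j.2, Sym2.eq_swap]⟩
    rw [Nat.card_coe_set_eq]
    refine (Set.ncard_le_ncard hsub (Finset.finite_toSet _)).trans ?_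
    rw [Set.ncard_coe_finset]
    exact Finset.card_image_le
  obtain ⟨c, hac, hcb, h1, h2⟩ := exists_apex_of_card (n := n) E
    (fun e he => ⟨(hmem.1 he).1, (hmem.1 he).2.2.1⟩)
    (fun e he e' he' => hncr (hmem.1 he).2 (hmem.1 he').2) hEcard
    (fun i hi => hmem.2 ⟨by omega, hsucc hi⟩) (hmem.2 ⟨by omega, hab⟩) hlen
  exact ⟨c, hac, hcb, (hmem.1 h1).2, (hmem.1 h2).2⟩

/-- An isolating set of the indexed polygon triangulation is one of the graph. -/
theorem iotaK_le_card {V : Type*} {G : SimpleGraph V} {n k : ℕ} (σ : Fin n ≃ V) (S : Finset ℕ)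
    (hS : ∀ v < n,
      ¬ Dominated (fun i j => ∃ (hi : i < n) (hj : j < n), G.Adj (σ ⟨i, hi⟩) (σ ⟨j, hj⟩)) S v →
      (residualNbrs n
        (fun i j => ∃ (hi : i < n) (hj : j < n), G.Adj (σ ⟨i, hi⟩) (σ ⟨j, hj⟩)) S v).card ≤ k) :
    iotaK G k ≤ S.card := by
  classical
  set adj : ℕ → ℕ → Prop := fun i j =>
    ∃ (hi : i < n) (hj : j < n), G.Adj (σ ⟨i, hi⟩) (σ ⟨j, hj⟩)
  have : Finite V := Finite.of_equiv _ σ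
  set T : Set V := {v | ((σ.symm v : Fin n) : ℕ) ∈ S} with hT
  have hdom : ∀ v, v ∉ closedNbhd G T → ¬ Dominated adj S (σ.symm v) := by
    rintro v hv (h | ⟨u, hu, hun, hvn, huv⟩)
    · exact hv (Or.inl h)
    · exact hv (Or.inr ⟨σ ⟨u, hun⟩, by simpa [hT] using hu, by simpa using huv⟩)
  have hTcard : T.ncard ≤ S.card := by
    rw [← Set.ncard_coe_finset S]
    exact Set.ncard_le_ncard_of_injOn (fun v => ((σ.symm v : Fin n) : ℕ)) (fun v hv => hv)
      (fun u _ v _ huv => σ.symm.injective (Fin.ext huv)) (Finset.finite_toSet _)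
  have hiso : IsKIsolating G k T → iotaK G k ≤ T.ncard := fun h =>
    Nat.sInf_le ⟨T, T.toFinite, h, rfl⟩
  refine (hiso fun v hv => ?_).trans hTcard
  refine le_trans ?_ (hS (σ.symm v) (σ.symm v).2 (hdom v hv))
  rw [← Set.ncard_coe_finset]
  refine Set.ncard_le_ncard_of_injOn (fun v => ((σ.symm v : Fin n) : ℕ)) (fun u hu => ?_)
    (fun u _ v _ huv => σ.symm.injective (Fin.ext huv)) (Finset.finite_toSet _)
  exact mem_residualNbrs.2
    ⟨(σ.symm u).2, ⟨(σ.symm v).2, (σ.symm u).2, by simpa using hu.1⟩, hdom u hu.2⟩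

/-- for `k ≥ 0` and a mop `G` of order `n ≥ k+4`,
`ι_k(G) ≤ n / (k+4)`. -/
theorem iotaK_mop_le {V : Type*} [Finite V] (k : ℕ)
    (G : SimpleGraph V) (hG : IsMop G) (h : k + 4 ≤ Nat.card V) :
    (iotaK G k : ℝ) ≤ (Nat.card V : ℝ) / (k + 4) := by
  obtain ⟨n, hn, σ, hσ⟩ := hG
  have hV : Nat.card V = n := by rw [← Nat.card_congr σ, Nat.card_fin]
  rw [hV] at h ⊢
  obtain ⟨S, hcard, hS⟩ := (hσ.isPolygonTriangulation hn).exists_isolating k (by omega)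
  have h1 : 1 ≤ n / (k + 4) := (Nat.one_le_div_iff (by omega)).2 h
  have hle : iotaK G k ≤ n / (k + 4) := by
    have := iotaK_le_card σ S hS
    omega
  calc (iotaK G k : ℝ) ≤ ((n / (k + 4) : ℕ) : ℝ) := by exact_mod_cast hle
    _ ≤ (n : ℝ) / ((k + 4 : ℕ) : ℝ) := Nat.cast_div_le
    _ = (n : ℝ) / (k + 4) := by push_cast; rfl

end MopPaper
end

section
/- If k ≥ 0, G is a maximal outerplanar graph of order n ≥ k+3, and n₂ is the number of vertices of G of degree 2, then the K_{1,k+1}-isolation number satisfies ι_k(G) ≤ (n + n₂)/(k+5). -/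
namespace MopPaper

/-- Binary trees with labelled inner nodes. Together with the two ends of a root edge, such a tree
describes a triangulated polygon: an inner node is a triangle on the current edge, and its label
is the apex of that triangle. -/
inductive TriTree (α : Type*) where
  | leaf : TriTree α
  | node : TriTree α → α → TriTree α → TriTree α

namespace TriTree

variable {α : Type*}

/-- Adjacency in the triangulated polygon of a tree with root edge `uv`. -/
def adj : TriTree α → α → α → α → α → Prop
  | leaf, u, v, x, y => (x = u ∧ y = v) ∨ (x = v ∧ y = u)
  | node l c r, u, v, x, y =>
      ((x = u ∧ y = v) ∨ (x = v ∧ y = u)) ∨ adj l u c x y ∨ adj r c v x y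

/-- The number of triangles. -/
def size : TriTree α → ℕ
  | leaf => 0
  | node l _ r => size l + size r + 1

/-- The number of triangles whose two edges other than the parent edge lie on the boundary. -/
def ears : TriTree α → ℕ
  | leaf => 0
  | node l _ r => max 1 (ears l + ears r)

/-- The reflected tree. -/
def mirror : TriTree α → TriTree α
  | leaf => leaf
  | node l c r => node (mirror r) c (mirror l)

variable [DecidableEq α]

/-- The labels of a tree. -/
def labels : TriTree α → Finset α
  | leaf => ∅
  | node l c r => insert c (labels l ∪ labels r)

/-- The vertices of the triangulated polygon of a tree with root edge `uv`. -/
def verts (t : TriTree α) (u v : α) : Finset α := insert u (insert v t.labels)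

/-- All vertices of the polygon are distinct. -/
def Proper : TriTree α → α → α → Prop
  | leaf, u, v => u ≠ v
  | node l c r, u, v => Proper l u c ∧ Proper r c v ∧
      ∀ x, x ∈ verts l u c → x ∈ verts r c v → x = c

omit [DecidableEq α] in
lemma adj_root (t : TriTree α) (u v : α) : t.adj u v u v := by cases t <;> simp [adj]

omit [DecidableEq α] in
lemma adj_symm {t : TriTree α} {u v x y : α} (h : t.adj u v x y) : t.adj u v y x := by
  induction t generalizing u v with
  | leaf => simp only [adj] at *; tauto
  | node l c r ihl ihr =>
    simp only [adj] at *
    rcases h with h | h | h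
    · tauto
    · exact .inr (.inl (ihl h))
    · exact .inr (.inr (ihr h))

lemma left_mem (t : TriTree α) (u v : α) : u ∈ t.verts u v := by simp [verts]

lemma right_mem (t : TriTree α) (u v : α) : v ∈ t.verts u v := by simp [verts]

lemma mem_verts_node {l r : TriTree α} {c u v x : α} :
    x ∈ (node l c r).verts u v ↔ x ∈ l.verts u c ∨ x ∈ r.verts c v := by
  simp only [verts, labels, Finset.mem_insert, Finset.mem_union]; tauto

lemma adj_mem {t : TriTree α} {u v x y : α} (h : t.adj u v x y) : x ∈ t.verts u v := by
  induction t generalizing u v with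
  | leaf => simp only [adj] at h; simp only [verts, Finset.mem_insert]; tauto
  | node l c r ihl ihr =>
    rcases h with h | h | h
    · simp only [verts, Finset.mem_insert]; tauto
    · exact mem_verts_node.2 (.inl (ihl h))
    · exact mem_verts_node.2 (.inr (ihr h))

lemma Proper.root_ne {t : TriTree α} {u v : α} (h : t.Proper u v) : u ≠ v := by
  induction t generalizing u v with
  | leaf => exact h
  | node l c r ihl ihr =>
    rintro rfl
    exact ihl h.1 (h.2.2 _ (left_mem ..) (right_mem ..))

lemma Proper.adj_ne {t : TriTree α} {u v x y : α} (h : t.Proper u v) (ha : t.adj u v x y) :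
    x ≠ y := by
  have h0 := h.root_ne
  induction t generalizing u v with
  | leaf => simp only [adj] at ha; grind
  | node l c r ihl ihr =>
    rcases ha with ha | ha | ha
    · grind
    · exact ihl h.1 ha h.1.root_ne
    · exact ihr h.2.1 ha h.2.1.root_ne

lemma Proper.not_mem_labels {t : TriTree α} {u v : α} (h : t.Proper u v) :
    u ∉ t.labels ∧ v ∉ t.labels := by
  induction t generalizing u v with
  | leaf => simp [labels]
  | node l c r ihl ihr =>
    obtain ⟨h1, h2, h3⟩ := h
    have := h1.root_ne
    have := h2.root_ne
    have := ihl h1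
    have := ihr h2
    simp only [verts, labels, Finset.mem_insert, Finset.mem_union] at *
    grind

lemma Proper.card_labels {t : TriTree α} {u v : α} (h : t.Proper u v) :
    t.labels.card = t.size := by
  induction t generalizing u v with
  | leaf => simp [labels, size]
  | node l c r ihl ihr =>
    obtain ⟨h1, h2, h3⟩ := h
    have e1 := h1.not_mem_labels
    have e2 := h2.not_mem_labels
    have hd : Disjoint l.labels r.labels := by
      rw [Finset.disjoint_left]
      intro x hx hy
      have := h3 x (by simp [verts, hx]) (by simp [verts, hy])
      grind
    rw [labels, Finset.card_insert_of_notMem (by simp [e1.2, e2.1]),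
      Finset.card_union_of_disjoint hd, ihl h1, ihr h2, size]

lemma Proper.card_verts {t : TriTree α} {u v : α} (h : t.Proper u v) :
    (t.verts u v).card = t.size + 2 := by
  have h0 := h.root_ne
  have h1 := h.not_mem_labels
  rw [verts, Finset.card_insert_of_notMem (by simp [h0, h1.1]),
    Finset.card_insert_of_notMem h1.2, h.card_labels]

omit [DecidableEq α] in
lemma mirror_mirror (t : TriTree α) : t.mirror.mirror = t := by
  induction t <;> simp_all [mirror]

omit [DecidableEq α] in
lemma size_mirror (t : TriTree α) : t.mirror.size = t.size := by
  induction t with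
  | leaf => rfl
  | node l c r ihl ihr => simp only [mirror, size, ihl, ihr]; omega

omit [DecidableEq α] in
lemma ears_mirror (t : TriTree α) : t.mirror.ears = t.ears := by
  induction t with
  | leaf => rfl
  | node l c r ihl ihr => simp only [mirror, ears, ihl, ihr]; omega

lemma labels_mirror (t : TriTree α) : t.mirror.labels = t.labels := by
  induction t with
  | leaf => rfl
  | node l c r ihl ihr => simp only [mirror, labels, ihl, ihr, Finset.union_comm]

lemma verts_mirror (t : TriTree α) (u v : α) : t.mirror.verts v u = t.verts u v := by
  simp only [verts, labels_mirror, Finset.insert_comm]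

omit [DecidableEq α] in
lemma adj_mirror (t : TriTree α) (u v : α) : t.mirror.adj v u = t.adj u v := by
  induction t generalizing u v with
  | leaf => funext x y; simp only [mirror, adj, eq_iff_iff]; tauto
  | node l c r ihl ihr => funext x y; simp only [mirror, adj, eq_iff_iff, ihl, ihr]; tauto

lemma Proper.mirror {t : TriTree α} {u v : α} (h : t.Proper u v) : t.mirror.Proper v u := by
  induction t generalizing u v with
  | leaf => exact Ne.symm h
  | node l c r ihl ihr =>
    refine ⟨ihr h.2.1, ihl h.1, fun x hx hy => ?_⟩
    rw [verts_mirror] at hx hy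
    exact h.2.2 x hy hx

omit [DecidableEq α] in
lemma ears_pos {t : TriTree α} (h : 0 < t.size) : 0 < t.ears := by
  cases t <;> simp_all [size, ears]

omit [DecidableEq α] in
lemma adj_change_left {t : TriTree α} {u c v x y : α} (h : t.adj u v x y) :
    t.adj c v x y ∨ (x = u ∧ t.adj c v c y) ∨ (y = u ∧ t.adj c v x c) := by
  induction t generalizing v with
  | leaf => simp only [adj] at *; tauto
  | node l m r ihl ihr =>
    simp only [adj] at *
    rcases h with h | h | h
    · tauto
    · have := ihl h; tauto
    · tauto

omit [DecidableEq α] in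
lemma adj_change_left_of_ne {t : TriTree α} {u c v x y : α} (h : t.adj c v x y)
    (hx : x ≠ c) (hy : y ≠ c) : t.adj u v x y := by
  induction t generalizing v with
  | leaf => simp only [adj] at *; tauto
  | node l m r ihl ihr =>
    simp only [adj] at *
    rcases h with h | h | h
    · tauto
    · have := ihl h; tauto
    · tauto

lemma Proper.change_left {t : TriTree α} {u c v : α} (h : t.Proper c v)
    (hu : u ∉ t.verts c v) : t.Proper u v := by
  induction t generalizing v with
  | leaf => simp only [verts, Finset.mem_insert] at hu; simp only [Proper]; grind
  | node l m r ihl ihr =>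
    obtain ⟨h1, h2, h3⟩ := h
    rw [mem_verts_node, not_or] at hu
    refine ⟨ihl h1 hu.1, h2, fun x hx hy => ?_⟩
    simp only [verts, Finset.mem_insert] at *
    grind

lemma Proper.adj_left {l r : TriTree α} {c u v x y : α} (h : (node l c r).Proper u v)
    (hx : x ∈ l.verts u c) (hu : x ≠ u) (hc : x ≠ c) (ha : (node l c r).adj u v x y) :
    l.adj u c x y := by
  have := h.2.2
  have := right_mem r c v
  rcases ha with ha | ha | ha
  · grind
  · exact ha
  · exact absurd (h.2.2 x hx (adj_mem ha)) hc

end TriTree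

open TriTree

section

variable {α : Type*} [DecidableEq α]

/-- `x` lies in the closed neighbourhood of `S` with respect to `R`. -/
def Dom (R : α → α → Prop) (S : Finset α) (x : α) : Prop := x ∈ S ∨ ∃ s ∈ S, R s x

/-- Every undominated vertex of `X` has at most `k` undominated neighbours. -/
def Isolates (R : α → α → Prop) (k : ℕ) (X S : Finset α) : Prop :=
  ∀ x ∈ X, ¬ Dom R S x → ∀ Y : Finset α, (∀ y ∈ Y, R x y ∧ ¬ Dom R S y) → Y.card ≤ k

omit [DecidableEq α] in
lemma Dom.mono {R R' : α → α → Prop} {S S' : Finset α} {x : α} (h : Dom R S x)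
    (hR : ∀ x y, R x y → R' x y) (hS : S ⊆ S') : Dom R' S' x := by
  rcases h with h | ⟨s, hs, h⟩
  · exact .inl (hS h)
  · exact .inr ⟨s, hS hs, hR _ _ h⟩

omit [DecidableEq α] in
lemma Isolates.lift {R R' : α → α → Prop} {k : ℕ} {X S S' : Finset α} (h : Isolates R k X S)
    (hR : ∀ x y, R x y → R' x y) (hS : S ⊆ S')
    (hX : ∀ x ∈ X, ¬ Dom R' S' x → ∀ y, R' x y → R x y) : Isolates R' k X S' := by
  intro x hx hd Y hY
  refine h x hx (fun h' => hd (h'.mono hR hS)) Y fun y hy => ?_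
  exact ⟨hX x hx hd y (hY y hy).1, fun h' => (hY y hy).2 (h'.mono hR hS)⟩

omit [DecidableEq α] in
lemma Isolates.subset {R : α → α → Prop} {k : ℕ} {X S X' : Finset α} (h : Isolates R k X S)
    (hX : X' ⊆ X) : Isolates R k X' S := fun x hx => h x (hX hx)

/-- If at most `k + 1` vertices are undominated, then the undominated part has degree at
most `k`. -/
lemma isolates_of_card_le {R : α → α → Prop} {k : ℕ} {X S Z : Finset α}
    (hR : ∀ x y, R x y → x ≠ y ∧ y ∈ X) (hZ : Z ⊆ X) (hd : ∀ z ∈ Z, Dom R S z)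
    (hc : X.card ≤ k + 1 + Z.card) : Isolates R k X S := by
  intro x hx hdx Y hY
  have h1 : Y ⊆ (X \ Z).erase x := by
    intro y hy
    have := hY y hy
    have := hR x y this.1
    simp only [Finset.mem_erase, Finset.mem_sdiff]
    grind
  have h2 := Finset.card_le_card h1
  have h3 : x ∈ X \ Z := by
    simp only [Finset.mem_sdiff]
    exact ⟨hx, fun h => hdx (hd x h)⟩
  rw [Finset.card_erase_of_mem h3, Finset.card_sdiff_of_subset hZ] at h2
  omega

/-- The graph `R''` on `X''` arises from the graph `R` on `X` by contracting `D ∪ {p}` to `p`,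
where `p` and `q` are the only vertices of `D ∪ {p}` with further neighbours. The vertex `e`
isolates `D ∪ {p}`, and `{p, f}` dominates everything that `p` dominates after the contraction. -/
structure Cut (k : ℕ) (R R'' : α → α → Prop) (X X'' : Finset α) (p q e f : α)
    (D : Finset α) : Prop where
  cover : ∀ x ∈ X, x ∈ D ∨ x ∈ X''
  subX : X'' ⊆ X
  subD : D ⊆ X
  disj : ∀ x ∈ D, x ∉ X''
  p_mem : p ∈ X''
  q_mem : q ∈ D
  keep : ∀ x y, x ∈ X'' → y ∈ X'' → R x y → R'' x y
  origin : ∀ x y, R'' x y → R x y ∨ (x = p ∧ R q y) ∨ (y = p ∧ R x q)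
  closed : ∀ d y, d ∈ D → d ≠ q → R d y → y ∈ D ∨ y = p
  e_p : Dom R {e} p
  e_q : Dom R {e} q
  e_iso : Isolates R k D {e}
  f_q : Dom R {p, f} q
  f_iso : Isolates R k D {p, f}
  f_dom : ∀ y, R q y → y ∈ D ∨ Dom R {p, f} y

namespace Cut

variable {k : ℕ} {R R'' : α → α → Prop} {X X'' D : Finset α} {p q e f : α}

/-- An isolating set of the contracted graph extends to one of the original graph. -/
lemma extend (h : Cut k R R'' X X'' p q e f D) (hs : ∀ x y, R x y → R y x)
    (hX : ∀ x y, R x y → x ∈ X)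
    {S S' : Finset α} (hS : Isolates R'' k X'' S) (hSS : S ⊆ S')
    (hp : Dom R S' p) (hq : Dom R S' q) (hD : Isolates R k D S')
    (hpS : p ∈ S → ∀ y, R q y → y ∈ D ∨ Dom R S' y) : Isolates R k X S' := by
  have key : ∀ x ∈ X'', ¬ Dom R S' x → ¬ Dom R'' S x := by
    rintro x hx hd (h' | ⟨s, hs', h'⟩)
    · exact hd (.inl (hSS h'))
    · rcases h.origin _ _ h' with h' | ⟨rfl, h'⟩ | ⟨rfl, h'⟩
      · exact hd (.inr ⟨s, hSS hs', h'⟩)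
      · rcases hpS hs' x h' with h' | h'
        · exact h.disj x h' hx
        · exact hd h'
      · exact hd hp
  intro x hx hd Y hY
  rcases h.cover x hx with hxD | hx''
  · exact hD x hxD hd Y hY
  · refine hS x hx'' (key x hx'' hd) Y fun y hy => ?_
    obtain ⟨h1, h2⟩ := hY y hy
    have hy'' : y ∈ X'' := by
      rcases h.cover y (hX _ _ (hs _ _ h1)) with hyD | hy''
      · have hyq : y ≠ q := by rintro rfl; exact h2 hq
        rcases h.closed y x hyD hyq (hs _ _ h1) with h' | rfl
        · exact absurd hx'' (h.disj x h')
        · exact absurd hp hd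
      · exact hy''
    exact ⟨h.keep x y hx'' hy'' h1, key y hy'' h2⟩

lemma exists_isolates (h : Cut k R R'' X X'' p q e f D) (hs : ∀ x y, R x y → R y x)
    (hX : ∀ x y, R x y → x ∈ X) {S : Finset α} (hS : Isolates R'' k X'' S) :
    ∃ S', Isolates R k X S' ∧ S'.card ≤ S.card + 1 := by
  by_cases hp : p ∈ S
  · refine ⟨insert f S, ?_, Finset.card_insert_le _ _⟩
    have hsub : ({p, f} : Finset α) ⊆ insert f S := by
      intro x hx; simp only [Finset.mem_insert, Finset.mem_singleton] at *; grind
    exact h.extend hs hX hS (Finset.subset_insert _ _) (.inl (by simp [hp]))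
      (h.f_q.mono (fun _ _ => id) hsub)
      (h.f_iso.lift (fun _ _ => id) hsub (fun _ _ _ _ => id))
      fun _ y hy => (h.f_dom y hy).imp_right fun h' => h'.mono (fun _ _ => id) hsub
  · refine ⟨insert e S, ?_, Finset.card_insert_le _ _⟩
    have hsub : ({e} : Finset α) ⊆ insert e S := by simp
    exact h.extend hs hX hS (Finset.subset_insert _ _)
      (h.e_p.mono (fun _ _ => id) hsub) (h.e_q.mono (fun _ _ => id) hsub)
      (h.e_iso.lift (fun _ _ => id) hsub (fun _ _ _ _ => id)) fun h' => absurd h' hp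

/-- If the contracted graph has at most `k + 2` vertices, then `e` alone is isolating. -/
lemma isolates_singleton (h : Cut k R R'' X X'' p q e f D) (hs : ∀ x y, R x y → R y x)
    (hX : ∀ x y, R x y → x ∈ X) (hne : ∀ x y, R x y → x ≠ y)
    (hc : X''.card ≤ k + 2) : Isolates R k X {e} := by
  intro x hx hd Y hY
  rcases h.cover x hx with hxD | hx''
  · exact h.e_iso x hxD hd Y hY
  · have hxp : x ≠ p := by rintro rfl; exact hd h.e_p
    have hsub : Y ⊆ (X''.erase p).erase x := by
      intro y hy
      obtain ⟨h1, h2⟩ := hY y hy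
      simp only [Finset.mem_erase]
      refine ⟨(hne _ _ h1).symm, by rintro rfl; exact h2 h.e_p, ?_⟩
      rcases h.cover y (hX _ _ (hs _ _ h1)) with hyD | hy''
      · have hyq : y ≠ q := by rintro rfl; exact h2 h.e_q
        rcases h.closed y x hyD hyq (hs _ _ h1) with h' | rfl
        · exact absurd hx'' (h.disj x h')
        · exact absurd h.e_p hd
      · exact hy''
    have := Finset.card_le_card hsub
    rw [Finset.card_erase_of_mem (by simp [hxp, hx'']), Finset.card_erase_of_mem h.p_mem] at this
    omega

end Cut

/-- Some set of one vertex dominates `u` and `v` and isolates the whole polygon. -/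
def OneIsolated (k : ℕ) (t : TriTree α) (u v : α) : Prop :=
  ∃ e, Dom (t.adj u v) {e} u ∧ Dom (t.adj u v) {e} v ∧
    Isolates (t.adj u v) k (t.verts u v) {e}

/-- The polygon of `t''` arises from that of `t` by a cut and contraction. -/
def Reduces (k : ℕ) (t : TriTree α) (u v : α) (t'' : TriTree α) : Prop :=
  t''.Proper u v ∧ ∃ p q e f D,
    Cut k (t.adj u v) (t''.adj u v) (t.verts u v) (t''.verts u v) p q e f D

/-- The three possibilities for a polygon of large weight. -/
def Reducible (k : ℕ) (t : TriTree α) (u v : α) : Prop :=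
  (OneIsolated k t u v ∧ Isolates (t.adj u v) k (t.verts u v) {u, v}) ∨
  (∃ t'', Reduces k t u v t'' ∧
    t''.size + max 1 t''.ears + (k + 5) ≤ t.size + t.ears) ∨
  (OneIsolated k t u v ∧ Reduces k t u v .leaf)

lemma Reducible.mirror {k : ℕ} {t : TriTree α} {u v : α} (h : Reducible k t u v) :
    Reducible k t.mirror v u := by
  have hr : ∀ t'', Reduces k t u v t'' → Reduces k t.mirror v u t''.mirror := by
    rintro t'' ⟨h1, h2⟩
    refine ⟨h1.mirror, ?_⟩
    simpa only [adj_mirror, verts_mirror] using h2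
  have ho : OneIsolated k t u v → OneIsolated k t.mirror v u := by
    rintro ⟨e, h1, h2, h3⟩
    refine ⟨e, ?_⟩
    simp only [adj_mirror, verts_mirror]
    exact ⟨h2, h1, h3⟩
  rcases h with ⟨h1, h2⟩ | ⟨t'', h1, h2⟩ | ⟨h1, h2⟩
  · refine .inl ⟨ho h1, ?_⟩
    simpa only [adj_mirror, verts_mirror, Finset.pair_comm v u] using h2
  · exact .inr (.inl ⟨_, hr _ h1, by simpa only [size_mirror, ears_mirror] using h2⟩)
  · exact .inr (.inr ⟨ho h1, hr _ h2⟩)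

lemma Isolates.lift_left {k : ℕ} {l r : TriTree α} {c u v : α} {S S' : Finset α}
    (h : (node l c r).Proper u v) (hI : Isolates (l.adj u c) k (l.verts u c) S) (hS : S ⊆ S')
    (hu : Dom ((node l c r).adj u v) S' u) (hc : Dom ((node l c r).adj u v) S' c) :
    Isolates ((node l c r).adj u v) k (l.verts u c) S' := by
  refine hI.lift (fun x y hxy => .inr (.inl hxy)) hS fun x hx hd y hxy => ?_
  refine h.adj_left hx ?_ ?_ hxy
  · rintro rfl; exact hd hu
  · rintro rfl; exact hd hc

/-- Cutting off the left subtree of the root. -/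
lemma reduces_left {k : ℕ} {l r : TriTree α} {c u v e f : α}
    (h : (node l c r).Proper u v)
    (hu : Dom (l.adj u c) {e} u) (hc : Dom (l.adj u c) {e} c)
    (hI : Isolates (l.adj u c) k (l.verts u c) {e})
    (hfc : Dom ((node l c r).adj u v) {u, f} c)
    (hfI : Isolates (l.adj u c) k (l.verts u c) {u, f})
    (hf : ∀ y, r.adj c v c y → Dom ((node l c r).adj u v) {u, f} y) :
    Reduces k (node l c r) u v r := by
  obtain ⟨h1, h2, h3⟩ := id h
  have huc := h1.root_ne
  have hcv := h2.root_ne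
  have hur : u ∉ r.verts c v := fun h' => huc (h3 u (left_mem ..) h')
  have hin := h2.not_mem_labels
  have hR : ∀ x y, l.adj u c x y → (node l c r).adj u v x y := fun x y hxy => .inr (.inl hxy)
  have huv : u ≠ v := h.root_ne
  have hlr : ∀ x, x ∈ l.verts u c → x ∈ r.verts u v → x = u := by
    intro x hx hy
    have := h3 x hx
    simp only [verts, Finset.mem_insert] at *
    grind
  refine ⟨h2.change_left hur, u, c, e, f, (l.verts u c).erase u, ?_⟩
  constructor
  · intro x hx
    rw [mem_verts_node] at hx
    simp only [verts, Finset.mem_insert, Finset.mem_erase] at *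
    grind
  · intro x hx
    rw [mem_verts_node]
    simp only [verts, Finset.mem_insert] at *
    grind
  · intro x hx
    rw [mem_verts_node]
    exact .inl (Finset.mem_of_mem_erase hx)
  · intro x hx hx'
    rw [Finset.mem_erase] at hx
    exact hx.1 (hlr x hx.2 hx')
  · exact left_mem ..
  · simp [huc.symm, right_mem]
  · intro x y hx hy hxy
    have hxc : x ≠ c := by rintro rfl; simp only [verts, Finset.mem_insert] at hx; grind
    have hyc : y ≠ c := by rintro rfl; simp only [verts, Finset.mem_insert] at hy; grind
    rcases hxy with hxy | hxy | hxy
    · rcases hxy with ⟨rfl, rfl⟩ | ⟨rfl, rfl⟩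
      · exact adj_root ..
      · exact adj_symm (adj_root ..)
    · have := hlr x (adj_mem hxy) hx
      have := hlr y (adj_mem (adj_symm hxy)) hy
      have := h1.adj_ne hxy
      grind
    · exact adj_change_left_of_ne hxy hxc hyc
  · intro x y hxy
    rcases adj_change_left (c := c) hxy with h' | h' | h'
    · exact .inl (.inr (.inr h'))
    · exact .inr (.inl ⟨h'.1, .inr (.inr h'.2)⟩)
    · exact .inr (.inr ⟨h'.1, .inr (.inr h'.2)⟩)
  · intro d y hd hdq hdy
    rw [Finset.mem_erase] at hd
    have := adj_mem (adj_symm (h.adj_left hd.2 hd.1 hdq hdy))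
    rw [Finset.mem_erase]
    tauto
  · exact hu.mono hR (Finset.Subset.refl _)
  · exact hc.mono hR (Finset.Subset.refl _)
  · exact (hI.lift_left h (Finset.Subset.refl _) (hu.mono hR (Finset.Subset.refl _))
      (hc.mono hR (Finset.Subset.refl _))).subset (Finset.erase_subset _ _)
  · exact hfc
  · exact (hfI.lift_left h (Finset.Subset.refl _) (.inl (by simp)) hfc).subset
      (Finset.erase_subset _ _)
  · intro y hy
    rcases hy with hy | hy | hy
    · grind
    · have := adj_mem (adj_symm hy)
      by_cases hyu : y = u
      · exact .inr (.inl (by simp [hyu]))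
      · exact .inl (by simp [hyu, this])
    · exact .inr (hf y hy)

/-- A reduction of the left subtree is a reduction of the whole tree. -/
lemma Reduces.node_left {k : ℕ} {l l'' r : TriTree α} {c u v : α}
    (h : (node l c r).Proper u v) (hl : Reduces k l u c l'') :
    Reduces k (node l c r) u v (node l'' c r) := by
  obtain ⟨h1, h2, h3⟩ := id h
  obtain ⟨h'', p, q, e, f, D, C⟩ := hl
  have huc := h1.root_ne
  have hR : ∀ x y, l.adj u c x y → (node l c r).adj u v x y := fun x y hxy => .inr (.inl hxy)
  have hu'' := left_mem l'' u c
  have hc'' := right_mem l'' u c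
  have hDu : ∀ d ∈ D, d ≠ u := by rintro d hd rfl; exact C.disj _ hd hu''
  have hDc : ∀ d ∈ D, d ≠ c := by rintro d hd rfl; exact C.disj _ hd hc''
  have hDl : ∀ d y, d ∈ D → (node l c r).adj u v d y → l.adj u c d y :=
    fun d y hd => h.adj_left (C.subD hd) (hDu d hd) (hDc d hd)
  have hss : ∀ S : Finset α, S ⊆ S := fun S => Finset.Subset.refl S
  refine ⟨⟨h'', h2, fun x hx => h3 x (C.subX hx)⟩, p, q, e, f, D, ?_⟩
  constructor
  · intro x hx
    rw [mem_verts_node] at *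
    rcases hx with hx | hx
    · rcases C.cover x hx with hx | hx <;> tauto
    · tauto
  · intro x hx
    rw [mem_verts_node] at *
    exact hx.imp_left fun h' => C.subX h'
  · intro x hx
    exact mem_verts_node.2 (.inl (C.subD hx))
  · intro x hx hx'
    rw [mem_verts_node] at hx'
    rcases hx' with hx' | hx'
    · exact C.disj x hx hx'
    · exact hDc x hx (h3 x (C.subD hx) hx')
  · exact mem_verts_node.2 (.inl C.p_mem)
  · exact C.q_mem
  · intro x y hx hy hxy
    have hm : ∀ z, z ∈ (node l'' c r).verts u v → z ∈ l.verts u c → z ∈ l''.verts u c := by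
      intro z hz hz'
      rcases mem_verts_node.1 hz with hz | hz
      · exact hz
      · rw [h3 z hz' hz]; exact hc''
    rcases hxy with hxy | hxy | hxy
    · exact .inl hxy
    · exact .inr (.inl (C.keep x y (hm x hx (adj_mem hxy))
        (hm y hy (adj_mem (adj_symm hxy))) hxy))
    · exact .inr (.inr hxy)
  · intro x y hxy
    rcases hxy with hxy | hxy | hxy
    · exact .inl (.inl hxy)
    · rcases C.origin x y hxy with h' | h' | h'
      · exact .inl (hR _ _ h')
      · exact .inr (.inl ⟨h'.1, hR _ _ h'.2⟩)
      · exact .inr (.inr ⟨h'.1, hR _ _ h'.2⟩)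
    · exact .inl (.inr (.inr hxy))
  · exact fun d y hd hdq hdy => C.closed d y hd hdq (hDl d y hd hdy)
  · exact C.e_p.mono hR (hss _)
  · exact C.e_q.mono hR (hss _)
  · exact C.e_iso.lift hR (hss _) fun x hx _ y => hDl x y hx
  · exact C.f_q.mono hR (hss _)
  · exact C.f_iso.lift hR (hss _) fun x hx _ y => hDl x y hx
  · intro y hy
    exact (C.f_dom y (hDl q y C.q_mem hy)).imp_right fun h' => h'.mono hR (hss _)

omit [DecidableEq α] in
lemma dom_of_mem {R : α → α → Prop} {S : Finset α} {s : α} (h : s ∈ S) : Dom R S s := .inl h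

omit [DecidableEq α] in
lemma dom_of_adj {R : α → α → Prop} {S : Finset α} {s x : α} (h : s ∈ S) (hx : R s x) :
    Dom R S x := .inr ⟨s, h, hx⟩

lemma isolates_of_adj {k : ℕ} {t : TriTree α} {u v e : α} (h : t.Proper u v) (he : e ∈ t.verts u v)
    {Z : Finset α} (hZ : ∀ z ∈ Z, t.adj u v e z) (hc : t.size ≤ k + Z.card) :
    Isolates (t.adj u v) k (t.verts u v) {e} := by
  have heZ : e ∉ Z := fun h' => h.adj_ne (hZ e h') rfl
  refine isolates_of_card_le (Z := insert e Z)
    (fun x y hxy => ⟨h.adj_ne hxy, adj_mem (adj_symm hxy)⟩) ?_ ?_ ?_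
  · intro z hz
    rcases Finset.mem_insert.1 hz with rfl | hz
    · exact he
    · exact adj_mem (adj_symm (hZ z hz))
  · intro z hz
    rcases Finset.mem_insert.1 hz with rfl | hz
    · exact dom_of_mem (by simp)
    · exact dom_of_adj (by simp) (hZ z hz)
  · rw [h.card_verts, Finset.card_insert_of_notMem heZ]; omega

lemma isolates_left_end {k : ℕ} {t : TriTree α} {u v : α} (h : t.Proper u v)
    (hs : t.size ≤ k + 2) : Isolates (t.adj u v) k (t.verts u v) {u} := by
  cases t with
  | leaf =>
    exact isolates_of_adj h (left_mem ..) (Z := {v}) (by simp [adj]) (by simp [size])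
  | node l c r =>
    have hcv := h.2.1.root_ne
    refine isolates_of_adj h (left_mem ..) (Z := {c, v}) ?_
      (by rw [Finset.card_pair hcv]; exact hs)
    intro z hz
    rcases Finset.mem_insert.1 hz with rfl | hz
    · exact .inr (.inl (adj_root ..))
    · rw [Finset.mem_singleton.1 hz]; exact adj_root ..

lemma isolates_right_end {k : ℕ} {t : TriTree α} {u v : α} (h : t.Proper u v)
    (hs : t.size ≤ k + 2) : Isolates (t.adj u v) k (t.verts u v) {v} := by
  have := isolates_left_end h.mirror (by rwa [size_mirror])
  rwa [adj_mirror, verts_mirror] at this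

lemma isolates_left_end_of_node {k : ℕ} {a b r : TriTree α} {c d u v : α}
    (h : (node (node a d b) c r).Proper u v) (hs : (node (node a d b) c r).size ≤ k + 3) :
    Isolates ((node (node a d b) c r).adj u v) k ((node (node a d b) c r).verts u v) {u} := by
  obtain ⟨h1, h2, h3⟩ := id h
  have hcv := h2.root_ne
  have hdc := h1.2.1.root_ne
  have hdv : d ≠ v := by
    rintro rfl
    exact hdc (h3 d (by simp [verts, labels]) (right_mem ..))
  refine isolates_of_adj h (left_mem ..) (Z := {d, c, v}) ?_ ?_
  · intro z hz
    simp only [Finset.mem_insert, Finset.mem_singleton] at hz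
    rcases hz with rfl | rfl | rfl
    · exact .inr (.inl (.inr (.inl (adj_root ..))))
    · exact .inr (.inl (adj_root ..))
    · exact adj_root ..
  · have : ({d, c, v} : Finset α).card = 3 := by
      rw [Finset.card_eq_three]; exact ⟨d, c, v, hdc, hdv, hcv, rfl⟩
    omega

lemma isolates_end {k : ℕ} {t : TriTree α} {u v : α} (h : t.Proper u v)
    (hs : t.size ≤ k + 3) : Isolates (t.adj u v) k (t.verts u v) {u} ∨
      Isolates (t.adj u v) k (t.verts u v) {v} := by
  by_cases hk : t.size ≤ k + 2
  · exact .inl (isolates_left_end h hk)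
  match t with
  | .leaf => simp [size] at hk
  | .node .leaf c .leaf => simp [size] at hk
  | .node (.node a d b) c r => exact .inl (isolates_left_end_of_node h hs)
  | .node .leaf c (.node a d b) =>
    rw [← size_mirror] at hs
    have := isolates_left_end_of_node (k := k) (u := v) (v := u) (c := c) (d := d)
      (a := b.mirror) (b := a.mirror) (r := leaf) h.mirror hs
    rw [← adj_mirror, ← verts_mirror]
    exact .inr this

lemma isolates_node {k : ℕ} {l r : TriTree α} {c u v : α} {S : Finset α}
    (hl : Isolates ((node l c r).adj u v) k (l.verts u c) S)
    (hr : Isolates ((node l c r).adj u v) k (r.verts c v) S) :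
    Isolates ((node l c r).adj u v) k ((node l c r).verts u v) S := by
  intro x hx
  rcases mem_verts_node.1 hx with hx | hx
  · exact hl x hx
  · exact hr x hx

lemma Isolates.lift_right {k : ℕ} {l r : TriTree α} {c u v : α} {S S' : Finset α}
    (h : (node l c r).Proper u v) (hI : Isolates (r.adj c v) k (r.verts c v) S) (hS : S ⊆ S')
    (hc : Dom ((node l c r).adj u v) S' c) (hv : Dom ((node l c r).adj u v) S' v) :
    Isolates ((node l c r).adj u v) k (r.verts c v) S' := by
  rw [← adj_mirror] at hc hv ⊢
  rw [← adj_mirror, ← verts_mirror] at hI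
  rw [← verts_mirror]
  exact hI.lift_left h.mirror hS hv hc

lemma reducible_of_size_le {k : ℕ} {l r : TriTree α} {c u v : α} (h : (node l c r).Proper u v)
    (hl : l.size ≤ k + 2) (hr : r.size ≤ k + 2) : Reducible k (node l c r) u v := by
  obtain ⟨h1, h2, -⟩ := id h
  have huc : (node l c r).adj u v u c := .inr (.inl (adj_root ..))
  have hcv : (node l c r).adj u v c v := .inr (.inr (adj_root ..))
  have hc : Dom ((node l c r).adj u v) {c} c := dom_of_mem (by simp)
  have hu : Dom ((node l c r).adj u v) {c} u := dom_of_adj (by simp) (adj_symm huc)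
  have hv : Dom ((node l c r).adj u v) {c} v := dom_of_adj (by simp) hcv
  have hc' : Dom ((node l c r).adj u v) {u, v} c := dom_of_adj (by simp) huc
  have hu' : Dom ((node l c r).adj u v) {u, v} u := dom_of_mem (by simp)
  have hv' : Dom ((node l c r).adj u v) {u, v} v := dom_of_mem (by simp)
  refine .inl ⟨⟨c, hu, hv, ?_⟩, ?_⟩
  · exact isolates_node
      ((isolates_right_end h1 hl).lift_left h (Finset.Subset.refl _) hu hc)
      ((isolates_left_end h2 hr).lift_right h (Finset.Subset.refl _) hc hv)
  · exact isolates_node ((isolates_left_end h1 hl).lift_left h (by simp) hu' hc')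
      ((isolates_right_end h2 hr).lift_right h (by simp) hc' hv')

lemma dom_of_leaf_right {l : TriTree α} {c u v e : α} (h : (node l c leaf).Proper u v) :
    ∀ y, (leaf : TriTree α).adj c v c y → Dom ((node l c leaf).adj u v) {u, e} y := by
  intro y hy
  have hcv := h.2.1.root_ne
  rcases hy with ⟨-, rfl⟩ | ⟨h', -⟩
  · exact dom_of_adj (s := u) (by simp) (adj_root ..)
  · exact absurd h' hcv

/-- A left subtree with exactly `k + 3` triangles can be cut off, or is almost everything. -/
lemma reducible_of_size_left {k : ℕ} {l r : TriTree α} {c u v : α}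
    (h : (node l c r).Proper u v) (hl : l.size = k + 3) : Reducible k (node l c r) u v := by
  obtain ⟨h1, h2, -⟩ := id h
  have huc : l.adj u c u c := adj_root ..
  have hR : ∀ x y, l.adj u c x y → (node l c r).adj u v x y := fun x y hxy => .inr (.inl hxy)
  obtain ⟨e, he, hI⟩ : ∃ e, (e = u ∨ e = c) ∧ Isolates (l.adj u c) k (l.verts u c) {e} := by
    rcases isolates_end h1 hl.le with hI | hI
    · exact ⟨u, .inl rfl, hI⟩
    · exact ⟨c, .inr rfl, hI⟩
  have hu : Dom (l.adj u c) {e} u := by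
    rcases he with rfl | rfl
    · exact dom_of_mem (by simp)
    · exact dom_of_adj (by simp) (adj_symm huc)
  have hc : Dom (l.adj u c) {e} c := by
    rcases he with rfl | rfl
    · exact dom_of_adj (by simp) huc
    · exact dom_of_mem (by simp)
  have hred : Reduces k (node l c r) u v r := by
    refine reduces_left h hu hc hI (f := c) (dom_of_mem (by simp)) ?_ ?_
    · exact hI.lift (fun _ _ => id) (by rcases he with rfl | rfl <;> simp) (fun _ _ _ _ => id)
    · exact fun y hy => dom_of_adj (s := c) (by simp) (.inr (.inr hy))
  have hlp := ears_pos (t := l) (by omega)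
  cases r with
  | node a d b =>
    have hrp := ears_pos (t := node a d b) (by simp [size])
    refine .inr (.inl ⟨_, hred, ?_⟩)
    rw [size.eq_2 l, ears.eq_2 l]
    omega
  | leaf =>
    refine .inr (.inr ⟨⟨e, hu.mono hR (Finset.Subset.refl _), ?_, ?_⟩, hred⟩)
    · rcases he with rfl | rfl
      · exact dom_of_adj (by simp) (adj_root ..)
      · exact dom_of_adj (by simp) (.inr (.inr (adj_root ..)))
    · refine isolates_node (hI.lift_left h (Finset.Subset.refl _)
        (hu.mono hR (Finset.Subset.refl _)) (hc.mono hR (Finset.Subset.refl _))) ?_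
      intro x hx hd
      simp only [verts, labels, Finset.mem_insert, Finset.notMem_empty, or_false] at hx
      exfalso
      rcases hx with rfl | rfl
      · exact hd (hc.mono hR (Finset.Subset.refl _))
      · apply hd
        rcases he with rfl | rfl
        · exact dom_of_adj (by simp) (adj_root ..)
        · exact dom_of_adj (by simp) (.inr (.inr (adj_root ..)))

lemma reducible_of_left {k : ℕ} {l r : TriTree α} {c u v : α}
    (h : (node l c r).Proper u v) (hl : k + 5 ≤ l.size + l.ears) (hred : Reducible k l u c) :
    Reducible k (node l c r) u v := by
  have hR : ∀ x y, l.adj u c x y → (node l c r).adj u v x y := fun x y hxy => .inr (.inl hxy)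
  have hcut : OneIsolated k l u c → r = leaf → Reduces k (node l c r) u v r := by
    rintro ⟨e, hu, hc, hI⟩ rfl
    have hsub : ({e} : Finset α) ⊆ {u, e} := by simp
    exact reduces_left h hu hc hI (f := e) (hc.mono hR hsub)
      (hI.lift (fun _ _ => id) hsub (fun _ _ _ _ => id)) (dom_of_leaf_right h)
  have hcount : r.size + max 1 r.ears + (k + 5) ≤ (node l c r).size + (node l c r).ears := by
    simp only [size, ears]; omega
  rcases hred with ⟨⟨e, hu, hc, hI⟩, hI'⟩ | ⟨l'', hl'', hcnt⟩ | ⟨ho, hl''⟩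
  · refine .inr (.inl ⟨r, ?_, hcount⟩)
    exact reduces_left h hu hc hI (f := c) (dom_of_mem (by simp)) hI'
      fun y hy => dom_of_adj (s := c) (by simp) (.inr (.inr hy))
  · refine .inr (.inl ⟨_, hl''.node_left h, ?_⟩)
    simp only [size, ears]; omega
  · by_cases hr : r = leaf
    · exact .inr (.inl ⟨r, hcut ho hr, hcount⟩)
    · have hrp : 0 < r.ears := by
        apply ears_pos
        cases r <;> simp_all [size]
      refine .inr (.inl ⟨_, hl''.node_left h, ?_⟩)
      simp only [size, ears]; omega

lemma reducible_of_weight {k : ℕ} {t : TriTree α} {u v : α} (h : t.Proper u v)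
    (hw : k + 5 ≤ t.size + t.ears) : Reducible k t u v := by
  induction t generalizing u v with
  | leaf => simp [size, ears] at hw
  | node l c r ihl ihr =>
    obtain ⟨h1, h2, -⟩ := id h
    have hm := h.mirror
    have hmr : Reducible k (mirror (node l c r)) v u → Reducible k (node l c r) u v := by
      intro h'
      have := h'.mirror
      rwa [mirror_mirror] at this
    by_cases hl : k + 5 ≤ l.size + l.ears
    · exact reducible_of_left h hl (ihl h1 hl)
    by_cases hr : k + 5 ≤ r.size + r.ears
    · exact hmr (reducible_of_left hm (by rwa [size_mirror, ears_mirror]) (ihr h2 hr).mirror)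
    have hlp := ears_pos (t := l)
    have hrp := ears_pos (t := r)
    by_cases hl' : l.size = k + 3
    · exact reducible_of_size_left h hl'
    by_cases hr' : r.size = k + 3
    · exact hmr (reducible_of_size_left hm (by rwa [size_mirror]))
    exact reducible_of_size_le h (by omega) (by omega)

/-- The bound on the isolation number for a triangulated polygon given as a tree. -/
theorem TriTree.Proper.exists_isolates {k : ℕ} {t : TriTree α} {u v : α} (h : t.Proper u v)
    (hs : k + 1 ≤ t.size) : ∃ S, Isolates (t.adj u v) k (t.verts u v) S ∧
      S.card * (k + 5) ≤ t.size + t.ears + 3 := by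
  induction hn : t.size + t.ears using Nat.strong_induction_on generalizing t with
  | _ n ih =>
    subst hn
    have hp := ears_pos (t := t) (by omega)
    have one : ∀ e, Isolates (t.adj u v) k (t.verts u v) {e} →
        ∃ S, Isolates (t.adj u v) k (t.verts u v) S ∧
          S.card * (k + 5) ≤ t.size + t.ears + 3 := fun e he =>
      ⟨{e}, he, by rw [Finset.card_singleton]; omega⟩
    by_cases hw : k + 5 ≤ t.size + t.ears
    · have hred : OneIsolated k t u v ∨ ∃ t'', Reduces k t u v t'' ∧
          t''.size + t''.ears + (k + 5) ≤ t.size + t.ears := by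
        rcases reducible_of_weight h hw with h' | ⟨t'', h', hc⟩ | h'
        · exact .inl h'.1
        · exact .inr ⟨t'', h', by omega⟩
        · exact .inl h'.1
      rcases hred with ⟨e, -, -, he⟩ | ⟨t'', ⟨h'', p, q, e, f, D, C⟩, hc⟩
      · exact one e he
      · by_cases hs'' : k + 1 ≤ t''.size
        · obtain ⟨S, hS, hSc⟩ := ih _ (by omega) h'' hs'' rfl
          obtain ⟨S', hS', hSc'⟩ :=
            C.exists_isolates (fun _ _ => adj_symm) (fun _ _ => adj_mem) hS
          refine ⟨S', hS', ?_⟩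
          calc S'.card * (k + 5) ≤ (S.card + 1) * (k + 5) := Nat.mul_le_mul_right _ hSc'
            _ = S.card * (k + 5) + (k + 5) := by ring
            _ ≤ t.size + t.ears + 3 := by omega
        · exact one e (C.isolates_singleton (fun _ _ => adj_symm) (fun _ _ => adj_mem)
            (fun _ _ => h.adj_ne) (by rw [h''.card_verts]; omega))
    · rcases isolates_end h (k := k) (by omega) with h' | h'
      · exact one _ h'
      · exact one _ h'

end

/-- `x` has exactly two neighbours with respect to `R`. -/
def HasTwoNbrs {α : Type*} (R : α → α → Prop) (x : α) : Prop :=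
  ∃ a b, a ≠ b ∧ ∀ y, R x y ↔ y = a ∨ y = b

lemma TriTree.Proper.exists_ears {α : Type*} [DecidableEq α] {t : TriTree α} {u v : α}
    (h : t.Proper u v) :
    ∃ D ⊆ t.labels, D.card = t.ears ∧ ∀ x ∈ D, HasTwoNbrs (t.adj u v) x := by
  induction t generalizing u v with
  | leaf => exact ⟨∅, by simp, by simp [ears], by simp⟩
  | node l c r ihl ihr =>
    obtain ⟨h1, h2, h3⟩ := id h
    have huv := h.root_ne
    have huc := h1.root_ne
    have hcv := h2.root_ne
    by_cases hlr : l = leaf ∧ r = leaf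
    · obtain ⟨rfl, rfl⟩ := hlr
      refine ⟨{c}, by simp [labels], by simp [ears], ?_⟩
      intro x hx
      rw [Finset.mem_singleton] at hx
      subst hx
      refine ⟨u, v, huv, fun y => ?_⟩
      simp only [adj]
      grind
    · obtain ⟨Dl, hDl, hcl, hl⟩ := ihl h1
      obtain ⟨Dr, hDr, hcr, hr⟩ := ihr h2
      have hpos : 1 ≤ l.ears + r.ears := by
        have : 0 < l.size ∨ 0 < r.size := by
          cases l <;> cases r <;> simp_all [size]
        rcases this with h' | h'
        · have := ears_pos h'; omega
        · have := ears_pos h'; omega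
      have hn1 := h1.not_mem_labels
      have hn2 := h2.not_mem_labels
      have hdisj : Disjoint Dl Dr := by
        rw [Finset.disjoint_left]
        intro x hx hx'
        have := h3 x (by simp [verts, hDl hx]) (by simp [verts, hDr hx'])
        exact hn1.2 (this ▸ hDl hx)
      refine ⟨Dl ∪ Dr, ?_, ?_, ?_⟩
      · intro x hx
        simp only [labels, Finset.mem_insert, Finset.mem_union] at *
        exact .inr (hx.imp (fun h' => hDl h') fun h' => hDr h')
      · rw [Finset.card_union_of_disjoint hdisj, ears, hcl, hcr]; omega
      · intro x hx
        rcases Finset.mem_union.1 hx with hx | hx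
        · obtain ⟨a, b, hab, hy⟩ := hl x hx
          refine ⟨a, b, hab, fun y => ?_⟩
          rw [← hy]
          refine ⟨h.adj_left (by simp [verts, hDl hx]) ?_ ?_, fun h' => .inr (.inl h')⟩
          · rintro rfl; exact hn1.1 (hDl hx)
          · rintro rfl; exact hn1.2 (hDl hx)
        · obtain ⟨a, b, hab, hy⟩ := hr x hx
          refine ⟨a, b, hab, fun y => ?_⟩
          rw [← hy, ← adj_mirror (node l c r), ← adj_mirror r]
          refine ⟨h.mirror.adj_left (by simp [verts, labels_mirror, hDr hx]) ?_ ?_,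
            fun h' => .inr (.inl h')⟩
          · rintro rfl; exact hn2.2 (hDr hx)
          · rintro rfl; exact hn2.1 (hDr hx)

open Classical in
/-- The edges of a graph on `ℕ` inside an interval. -/
noncomputable def edgesIn (R : ℕ → ℕ → Prop) (a b : ℕ) : Finset (ℕ × ℕ) :=
  (Finset.Icc a b ×ˢ Finset.Icc a b).filter fun p => p.1 < p.2 ∧ R p.1 p.2

lemma mem_edgesIn {R : ℕ → ℕ → Prop} {a b : ℕ} {p : ℕ × ℕ} :
    p ∈ edgesIn R a b ↔ a ≤ p.1 ∧ p.2 ≤ b ∧ p.1 < p.2 ∧ R p.1 p.2 := by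
  simp only [edgesIn, Finset.mem_filter, Finset.mem_product, Finset.mem_Icc]
  constructor
  · rintro ⟨⟨⟨_, _⟩, _, _⟩, _, _⟩; tauto
  · rintro ⟨_, _, _, _⟩; exact ⟨⟨⟨by omega, by omega⟩, by omega, by omega⟩, by omega, by assumption⟩

/-- The third vertex of the triangle on `ab`: the last neighbour of `a` before `b`. -/
lemma exists_apex {R : ℕ → ℕ → Prop}
    (hc : ∀ a b c d, R a b → R c d → ¬ (a < c ∧ c < b ∧ b < d)) {a b : ℕ} (hab : a + 2 ≤ b)
    (hR : R a (a + 1)) :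
    ∃ m, a < m ∧ m < b ∧ edgesIn R a b ⊆ insert (a, b) (edgesIn R a m ∪ edgesIn R m b) := by
  classical
  let F := (Finset.Ioo a b).filter fun x => R a x
  have hF : F.Nonempty := ⟨a + 1, by simp [F, hR]; omega⟩
  have hm := F.max'_mem hF
  set m := F.max' hF
  simp only [F, Finset.mem_filter, Finset.mem_Ioo] at hm
  refine ⟨m, hm.1.1, hm.1.2, ?_⟩
  rintro ⟨x, y⟩ hxy
  simp only [Finset.mem_insert, Finset.mem_union, mem_edgesIn, Prod.mk.injEq] at *
  obtain ⟨h1, h2, h3, h4⟩ := hxy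
  rcases le_or_gt y m with hy | hy
  · exact .inr (.inl ⟨h1, hy, h3, h4⟩)
  rcases le_or_gt m x with hx | hx
  · exact .inr (.inr ⟨hx, h2, h3, h4⟩)
  have hxa : x = a := by
    by_contra hne
    exact hc _ _ _ _ hm.2 h4 ⟨by omega, hx, hy⟩
  subst hxa
  refine .inl ⟨rfl, ?_⟩
  by_contra hne
  have : y ∈ F := by simp only [F, Finset.mem_filter, Finset.mem_Ioo]; exact ⟨⟨h3, by omega⟩, h4⟩
  have := F.le_max' y this
  omega

/-- A non-crossing graph on an interval has at most `2 (b - a) - 1` edges, and in case of equality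
it is a triangulated polygon. -/
lemma edgesIn_card_le {R : ℕ → ℕ → Prop} (hs : ∀ x y, R x y → R y x) (hirr : ∀ x, ¬ R x x)
    (hc : ∀ a b c d, R a b → R c d → ¬ (a < c ∧ c < b ∧ b < d)) {a b : ℕ} (hab : a < b)
    (hR : ∀ i, a ≤ i → i < b → R i (i + 1)) :
    (edgesIn R a b).card ≤ 2 * (b - a) - 1 ∧
    (2 * (b - a) - 1 ≤ (edgesIn R a b).card → ∃ t : TriTree ℕ, t.Proper a b ∧
      (∀ x, x ∈ t.verts a b ↔ a ≤ x ∧ x ≤ b) ∧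
      ∀ x y, a ≤ x → x ≤ b → a ≤ y → y ≤ b → (R x y ↔ t.adj a b x y)) := by
  induction hn : b - a using Nat.strong_induction_on generalizing a b with
  | _ n ih =>
    subst hn
    by_cases hab1 : b = a + 1
    · subst hab1
      have hsub : edgesIn R a (a + 1) ⊆ {(a, a + 1)} := by
        rintro ⟨x, y⟩ hxy
        rw [mem_edgesIn] at hxy
        simp only [Finset.mem_singleton, Prod.mk.injEq] at *
        omega
      refine ⟨by have := Finset.card_le_card hsub; simp at this; omega, fun _ => ?_⟩
      have hR0 := hR a le_rfl (by omega)
      refine ⟨.leaf, by simp [Proper], ?_, ?_⟩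
      · intro x; simp only [verts, labels, insert_empty_eq, Finset.mem_insert,
          Finset.mem_singleton]; omega
      · intro x y hx hx' hy hy'
        have : x = a ∨ x = a + 1 := by omega
        have : y = a ∨ y = a + 1 := by omega
        have := hirr a
        have := hirr (a + 1)
        have := hs _ _ hR0
        simp only [adj]
        grind
    · obtain ⟨m, ham, hmb, hsub⟩ := exists_apex hc (a := a) (b := b) (by omega)
        (hR a le_rfl hab)
      obtain ⟨l1, l2⟩ := ih (m - a) (by omega) ham (fun i h1 h2 => hR i h1 (by omega)) rfl
      obtain ⟨r1, r2⟩ := ih (b - m) (by omega) hmb (fun i h1 h2 => hR i (by omega) h2) rfl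
      have hcard := Finset.card_le_card hsub
      have hins := Finset.card_insert_le (a, b) (edgesIn R a m ∪ edgesIn R m b)
      have hun := Finset.card_union_le (edgesIn R a m) (edgesIn R m b)
      refine ⟨by omega, fun hge => ?_⟩
      obtain ⟨l, hl, hlv, hla⟩ := l2 (by omega)
      obtain ⟨r, hr, hrv, hra⟩ := r2 (by omega)
      have hRab : R a b := by
        by_contra hno
        have hsub' : edgesIn R a b ⊆ edgesIn R a m ∪ edgesIn R m b := by
          intro p hp
          rcases Finset.mem_insert.1 (hsub hp) with rfl | hp'
          · rw [mem_edgesIn] at hp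
            exact absurd hp.2.2.2 hno
          · exact hp'
        have := Finset.card_le_card hsub'
        omega
      refine ⟨.node l m r, ⟨hl, hr, ?_⟩, ?_, ?_⟩
      · intro x hx hx'
        rw [hlv] at hx
        rw [hrv] at hx'
        omega
      · intro x
        rw [mem_verts_node, hlv, hrv]
        omega
      · have hfwd : ∀ x y, a ≤ x → y ≤ b → x < y → R x y → (node l m r).adj a b x y := by
          intro x y hx hy hxy hRxy
          have hp : (x, y) ∈ edgesIn R a b := mem_edgesIn.2 ⟨hx, hy, hxy, hRxy⟩
          have hp' := hsub hp
          simp only [Finset.mem_insert, Finset.mem_union, mem_edgesIn, Prod.mk.injEq] at hp'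
          rcases hp' with hp' | hp' | hp'
          · exact .inl (.inl hp')
          · exact .inr (.inl ((hla x y (by omega) (by omega) (by omega) (by omega)).1 hRxy))
          · exact .inr (.inr ((hra x y (by omega) (by omega) (by omega) (by omega)).1 hRxy))
        intro x y hx hx' hy hy'
        constructor
        · intro hRxy
          rcases lt_trichotomy x y with h' | rfl | h'
          · exact hfwd x y hx hy' h' hRxy
          · exact absurd hRxy (hirr x)
          · exact adj_symm (hfwd y x hy hx' h' (hs _ _ hRxy))
        · intro hxy
          rcases hxy with (⟨rfl, rfl⟩ | ⟨rfl, rfl⟩) | hxy | hxy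
          · exact hRab
          · exact hs _ _ hRab
          · have e1 := (hlv x).1 (adj_mem hxy)
            have e2 := (hlv y).1 (adj_mem (adj_symm hxy))
            exact (hla x y e1.1 e1.2 e2.1 e2.2).2 hxy
          · have e1 := (hrv x).1 (adj_mem hxy)
            have e2 := (hrv y).1 (adj_mem (adj_symm hxy))
            exact (hra x y e1.1 e1.2 e2.1 e2.2).2 hxy

/-- A tree on `0, …, n - 1` describing the graph `G` via the ordering `σ` of its vertices. -/
def Describes {V : Type*} (G : SimpleGraph V) (n : ℕ) (σ : Fin n ≃ V) (t : TriTree ℕ) : Prop :=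
  t.Proper 0 (n - 1) ∧ (∀ x, x ∈ t.verts 0 (n - 1) ↔ x < n) ∧
    ∀ i j : Fin n, G.Adj (σ i) (σ j) ↔ t.adj 0 (n - 1) i j

lemma MopWitness.exists_describes {V : Type*} {G : SimpleGraph V} {n : ℕ} {σ : Fin n ≃ V}
    (h : MopWitness G n σ) (hn : 3 ≤ n) : ∃ t, Describes G n σ t := by
  obtain ⟨hham, hcross, hcard⟩ := h
  let R : ℕ → ℕ → Prop := fun x y => ∃ (hx : x < n) (hy : y < n), G.Adj (σ ⟨x, hx⟩) (σ ⟨y, hy⟩)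
  have hs : ∀ x y, R x y → R y x := fun x y ⟨hx, hy, h⟩ => ⟨hy, hx, h.symm⟩
  have hirr : ∀ x, ¬ R x x := fun x ⟨hx, hy, h⟩ => G.irrefl h
  have hc : ∀ a b c d, R a b → R c d → ¬ (a < c ∧ c < b ∧ b < d) :=
    fun a b c d ⟨ha, hb, hab⟩ ⟨hc, hd, hcd⟩ h => hcross _ _ _ _ hab hcd h
  have hR : ∀ i, 0 ≤ i → i < n - 1 → R i (i + 1) := by
    intro i _ hi
    refine ⟨by omega, by omega, ?_⟩
    have := hham ⟨i, by omega⟩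
    have e : finNext (⟨i, by omega⟩ : Fin n) = ⟨i + 1, by omega⟩ := by
      simp only [finNext, Fin.mk.injEq]
      exact Nat.mod_eq_of_lt (by omega)
    rwa [e] at this
  have hE : G.edgeSet.ncard ≤ (edgesIn R 0 (n - 1)).card := by
    rw [← Set.ncard_coe_finset]
    let f : ℕ × ℕ → Sym2 V := fun p =>
      s(σ ⟨p.1 % n, Nat.mod_lt _ (by omega)⟩, σ ⟨p.2 % n, Nat.mod_lt _ (by omega)⟩)
    refine le_trans (Set.ncard_le_ncard (t := f '' (edgesIn R 0 (n - 1) : Set (ℕ × ℕ))) ?_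
      ((Finset.finite_toSet _).image f)) (Set.ncard_image_le (Finset.finite_toSet _))
    have key : ∀ i j : Fin n, i < j → G.Adj (σ i) (σ j) →
        s(σ i, σ j) ∈ f '' (edgesIn R 0 (n - 1) : Set (ℕ × ℕ)) := by
      intro i j hij ha
      refine ⟨(i, j), ?_, ?_⟩
      · rw [Finset.mem_coe, mem_edgesIn]
        exact ⟨Nat.zero_le _, by dsimp; omega, hij, i.2, j.2, ha⟩
      · simp only [f, Nat.mod_eq_of_lt i.2, Nat.mod_eq_of_lt j.2]
    intro e he
    induction e using Sym2.ind with
    | _ x y =>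
      rw [SimpleGraph.mem_edgeSet] at he
      obtain ⟨i, rfl⟩ := σ.surjective x
      obtain ⟨j, rfl⟩ := σ.surjective y
      rcases lt_trichotomy i j with hij | rfl | hij
      · exact key i j hij he
      · exact absurd he (G.irrefl)
      · rw [Sym2.eq_swap]; exact key j i hij he.symm
  have hcard' : G.edgeSet.ncard = 2 * n - 3 := hcard
  obtain ⟨t, ht, hv, ha⟩ := (edgesIn_card_le hs hirr hc (by omega) hR).2 (by omega)
  refine ⟨t, ht, fun x => by rw [hv]; omega, fun i j => ?_⟩
  rw [← ha i j (by omega) (by omega) (by omega) (by omega)]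
  exact ⟨fun h => ⟨i.2, j.2, h⟩, fun ⟨_, _, h⟩ => h⟩

lemma MopWitness.rotate {V : Type*} {G : SimpleGraph V} {n : ℕ} {σ : Fin n ≃ V}
    (h : MopWitness G n σ) (r : Fin n) :
    ∃ σ' : Fin n ≃ V, MopWitness G n σ' ∧ σ' ⟨0, r.pos⟩ = σ r := by
  have : NeZero n := ⟨by have := r.pos; omega⟩
  obtain ⟨hham, hcross, hcard⟩ := h
  refine ⟨(Equiv.addRight r).trans σ, ⟨fun i => ?_, ?_, hcard⟩, ?_⟩
  · have e : finNext i + r = finNext (i + r) := by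
      apply Fin.ext
      simp only [finNext, Fin.val_add, Nat.mod_add_mod]
      congr 1; omega
    simp only [Equiv.trans_apply, Equiv.coe_addRight, e]
    exact hham _
  · intro a b c d hab hcd hlt
    simp only [Equiv.trans_apply, Equiv.coe_addRight] at hab hcd
    have hval : ∀ i : Fin n, ((i + r : Fin n) : ℕ) = i + r ∧ (i : ℕ) + r < n ∨
        ((i + r : Fin n) : ℕ) + n = i + r ∧ n ≤ (i : ℕ) + r := by
      intro i
      rw [Fin.val_add]
      rcases lt_or_ge ((i : ℕ) + r) n with hi | hi
      · exact .inl ⟨Nat.mod_eq_of_lt hi, hi⟩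
      · refine .inr ⟨?_, hi⟩
        rw [Nat.mod_eq_sub_mod hi, Nat.mod_eq_of_lt (by omega)]
        omega
    have h1 := hcross _ _ _ _ hab hcd
    have h2 := hcross _ _ _ _ hcd.symm hab
    have h3 := hcross _ _ _ _ hab.symm hcd.symm
    have h4 := hcross _ _ _ _ hcd hab.symm
    have ha := hval a
    have hb := hval b
    have hc := hval c
    have hd := hval d
    simp only [Fin.lt_def] at *
    omega
  · simp only [Equiv.trans_apply, Equiv.coe_addRight]
    congr 1
    exact zero_add r

namespace Describes

variable {V : Type*} {G : SimpleGraph V} {n : ℕ} {σ : Fin n ≃ V} {t : TriTree ℕ}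

lemma mem_deg2set (h : Describes G n σ t) {i : Fin n}
    (hi : HasTwoNbrs (t.adj 0 (n - 1)) i) : σ i ∈ deg2set G := by
  obtain ⟨-, hv, ha⟩ := h
  obtain ⟨a, b, hab, hy⟩ := hi
  have han := (hv a).1 (adj_mem (adj_symm ((hy a).2 (.inl rfl))))
  have hbn := (hv b).1 (adj_mem (adj_symm ((hy b).2 (.inr rfl))))
  have e : G.neighborSet (σ i) = {σ ⟨a, han⟩, σ ⟨b, hbn⟩} := by
    ext w
    obtain ⟨j, rfl⟩ := σ.surjective w
    simp only [SimpleGraph.mem_neighborSet, ha, hy, Set.mem_insert_iff, Set.mem_singleton_iff,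
      EmbeddingLike.apply_eq_iff_eq, Fin.ext_iff]
  rw [deg2set, Set.mem_ofPred_eq, e, Set.ncard_pair]
  simpa using hab

lemma card_eq (h : Describes G n σ t) : t.size + 2 = n := by
  have e : t.verts 0 (n - 1) = Finset.range n := by
    ext x; rw [h.2.1, Finset.mem_range]
  rw [← h.1.card_verts, e, Finset.card_range]

lemma exists_mem_deg2set (h : Describes G n σ t) (hn : 3 ≤ n) : ∃ i, σ i ∈ deg2set G := by
  obtain ⟨D, hD, hc, hD2⟩ := h.1.exists_ears
  have := ears_pos (t := t) (by have := h.card_eq; omega)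
  obtain ⟨x, hx⟩ := Finset.card_pos.1 (by omega : 0 < D.card)
  have hxn := (h.2.1 x).1 (by simp [verts, hD hx])
  exact ⟨⟨x, hxn⟩, h.mem_deg2set (hD2 x hx)⟩

lemma ears_lt [Finite V] (h : Describes G n σ t) (hn : 0 < n)
    (h0 : σ ⟨0, hn⟩ ∈ deg2set G) : t.ears + 1 ≤ (deg2set G).ncard := by
  obtain ⟨D, hD, hc, hD2⟩ := h.1.exists_ears
  have h0D : 0 ∉ D := fun h' => h.1.not_mem_labels.1 (hD h')
  let f : ℕ → V := fun x => σ ⟨x % n, Nat.mod_lt _ hn⟩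
  have hlt : ∀ x ∈ insert 0 D, x < n := by
    intro x hx
    rcases Finset.mem_insert.1 hx with rfl | hx
    · exact hn
    · exact (h.2.1 x).1 (by simp [verts, hD hx])
  rw [← hc, ← Finset.card_insert_of_notMem h0D, ← Set.ncard_coe_finset]
  refine Set.ncard_le_ncard_of_injOn f ?_ ?_ (Set.toFinite _)
  · intro x hx
    have hx' : x ∈ insert 0 D := hx
    have hxn := hlt x hx'
    have e : f x = σ ⟨x, hxn⟩ := by simp only [f, Nat.mod_eq_of_lt hxn]
    rw [e]
    rcases Finset.mem_insert.1 hx' with rfl | hx'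
    · exact h0
    · exact h.mem_deg2set (hD2 x hx')
  · intro x hx y hy hxy
    simpa only [f, EmbeddingLike.apply_eq_iff_eq, Fin.mk.injEq, Nat.mod_eq_of_lt (hlt x hx),
      Nat.mod_eq_of_lt (hlt y hy)] using hxy

lemma iotaK_le [Finite V] (h : Describes G n σ t) {k : ℕ} {S : Finset ℕ}
    (hS : Isolates (t.adj 0 (n - 1)) k (t.verts 0 (n - 1)) S) : iotaK G k ≤ S.card := by
  obtain ⟨-, hv, ha⟩ := h
  let T : Set V := {w | ((σ.symm w : Fin n) : ℕ) ∈ S}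
  have hinj : Function.Injective fun w : V => ((σ.symm w : Fin n) : ℕ) :=
    Fin.val_injective.comp σ.symm.injective
  have hadj : ∀ v w, G.Adj v w ↔ t.adj 0 (n - 1) (σ.symm v : Fin n) (σ.symm w : Fin n) := by
    intro v w
    rw [← ha, Equiv.apply_symm_apply, Equiv.apply_symm_apply]
  have hdom : ∀ v, v ∈ (closedNbhd G T)ᶜ → ¬ Dom (t.adj 0 (n - 1)) S (σ.symm v : Fin n) := by
    rintro v hv' (hd | ⟨s, hs, hd⟩)
    · exact hv' (.inl hd)
    · have hsn := (hv s).1 (adj_mem hd)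
      refine hv' (.inr ⟨σ ⟨s, hsn⟩, ?_, ?_⟩)
      · simpa only [T, Set.mem_ofPred_eq, Equiv.symm_apply_apply] using hs
      · rw [hadj]; simpa only [Equiv.symm_apply_apply] using hd
  have hle : T.ncard ≤ S.card := by
    rw [← Set.ncard_coe_finset]
    exact Set.ncard_le_ncard_of_injOn _ (fun w hw => hw) hinj.injOn (Finset.finite_toSet _)
  refine le_trans (Nat.sInf_le ⟨T, Set.toFinite _, ?_, rfl⟩) hle
  intro v hv'
  have hfin : (G.neighborSet v ∩ (closedNbhd G T)ᶜ).Finite := Set.toFinite _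
  rw [Set.ncard_eq_toFinset_card _ hfin, ← Finset.card_image_of_injective _ hinj]
  refine hS _ ((hv _).2 (Fin.is_lt _)) (hdom v hv') _ fun y hy => ?_
  obtain ⟨w, hw, rfl⟩ := Finset.mem_image.1 hy
  rw [Set.Finite.mem_toFinset] at hw
  exact ⟨(hadj v w).1 hw.1, hdom w hw.2⟩

end Describes

/-- for `k ≥ 0` and a mop `G` of order `n ≥ k+3` with `n₂`
vertices of degree 2, `ι_k(G) ≤ (n + n₂) / (k+5)`. -/
theorem iotaK_mop_le_add {V : Type*} [Finite V] (k : ℕ)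
    (G : SimpleGraph V) (hG : IsMop G) (h : k + 3 ≤ Nat.card V) :
    (iotaK G k : ℝ) ≤ ((Nat.card V : ℝ) + ((deg2set G).ncard : ℝ)) / (k + 5) := by
  obtain ⟨n, hn, σ₀, hσ₀⟩ := hG
  obtain ⟨t₀, ht₀⟩ := hσ₀.exists_describes hn
  obtain ⟨i, hi⟩ := ht₀.exists_mem_deg2set hn
  obtain ⟨σ, hσ, h0⟩ := hσ₀.rotate i
  obtain ⟨t, ht⟩ := hσ.exists_describes hn
  rw [← h0] at hi
  have hears := ht.ears_lt (by omega) hi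
  have hsize := ht.card_eq
  have hcard : Nat.card V = n := by rw [← Nat.card_congr σ, Nat.card_fin]
  obtain ⟨S, hS, hSc⟩ := ht.1.exists_isolates (k := k) (by omega)
  have hle := ht.iotaK_le hS
  rw [le_div_iff₀ (by positivity)]
  have hfin : iotaK G k * (k + 5) ≤ Nat.card V + (deg2set G).ncard :=
    (Nat.mul_le_mul_right _ hle).trans (by omega)
  exact_mod_cast hfin

end MopPaper
end
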